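/- arXiv:2002.02500 — 2 statements merged into one kernel-verified Lean document; each statement's English description precedes it below -/
import Mathlib

section
/- Let c > 0 and let λ : [0,1] → ℂ be continuous with λ(t) an eigenvalue of H_t(c) for every t ∈ [0,1]. Suppose d ∈ [0,1) is such that λ(t) ∈ ℝ for all t ∈ [0,d] and such that for every δ > 0 there exists t ∈ (d, min(d+δ,1)] with λ(t) ∉ ℝ (i.e., d is the greatest number for which λ is real on [0,d]). Then λ(t) ∉ ℝ for every t ∈ (d,1]. -/
/-- `lam` is an eigenvalue of the Mathieu-type operator `H_t(c)` with potential
`2ic·cos(2x)` on `[0,π]`, with boundary conditions `y(π) = e^{iπt} y(0)`,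
`y'(π) = e^{iπt} y'(0)`. -/
def mathieuEV (c t : ℝ) (lam : ℂ) : Prop :=
  ∃ y : ℝ → ℂ, ContDiff ℝ 2 y ∧ (∃ x ∈ Set.Icc (0 : ℝ) Real.pi, y x ≠ 0) ∧
    (∀ x ∈ Set.Icc (0 : ℝ) Real.pi,
      -(deriv (deriv y) x) + 2 * Complex.I * (c : ℂ) * Complex.cos (2 * (x : ℂ)) * y x
        = lam * y x) ∧
    y Real.pi = Complex.exp (Complex.I * (Real.pi : ℂ) * (t : ℂ)) * y 0 ∧
    deriv y Real.pi = Complex.exp (Complex.I * (Real.pi : ℂ) * (t : ℂ)) * deriv y 0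

noncomputable section MathieuAux

theorem mth_L : (0 : ℝ) ≤ Real.pi / 2 := by positivity

abbrev MthX := C(Set.Icc (0 : ℝ) (Real.pi / 2), ℂ)

/-- extension by constants -/
def mthExt (f : MthX) : ℝ → ℂ := Set.IccExtend mth_L f

theorem mthExt_cont (f : MthX) : Continuous (mthExt f) := f.continuous.Icc_extend'

theorem mthExt_of_mem (f : MthX) {x : ℝ} (hx : x ∈ Set.Icc (0 : ℝ) (Real.pi / 2)) :
    mthExt f x = f ⟨x, hx⟩ := Set.IccExtend_of_mem _ _ hx

theorem mthExt_norm (f : MthX) (x : ℝ) : ‖mthExt f x‖ ≤ ‖f‖ := f.norm_coe_le_norm _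

def mthInt (f : MthX) (x : ℝ) : ℂ := ∫ s in (0 : ℝ)..x, mthExt f s

theorem mthInt_deriv (f : MthX) (x : ℝ) : HasDerivAt (mthInt f) (mthExt f x) x :=
  intervalIntegral.integral_hasDerivAt_right ((mthExt_cont f).intervalIntegrable _ _)
    ((mthExt_cont f).stronglyMeasurableAtFilter _ _) (mthExt_cont f).continuousAt

theorem mthInt_cont (f : MthX) : Continuous (mthInt f) :=
  continuous_iff_continuousAt.2 fun x => (mthInt_deriv f x).continuousAt

/-- Volterra operator -/
def mthV : MthX →L[ℂ] MthX :=
  LinearMap.mkContinuous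
    { toFun := fun f => ⟨fun x => mthInt f x, (mthInt_cont f).comp continuous_subtype_val⟩
      map_add' := by
        intro f g
        ext x
        change (∫ s in (0 : ℝ)..x, mthExt (f + g) s) = (∫ s in (0 : ℝ)..x, mthExt f s)
          + ∫ s in (0 : ℝ)..x, mthExt g s
        rw [← intervalIntegral.integral_add ((mthExt_cont f).intervalIntegrable _ _)
          ((mthExt_cont g).intervalIntegrable _ _)]
        rfl
      map_smul' := by
        intro a f
        ext x
        change (∫ s in (0 : ℝ)..x, mthExt (a • f) s) = a • ∫ s in (0 : ℝ)..x, mthExt f s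
        rw [← intervalIntegral.integral_smul]
        rfl }
    (Real.pi / 2) (by
      intro f
      rw [ContinuousMap.norm_le _ (by positivity)]
      intro x
      change ‖∫ s in (0 : ℝ)..x, mthExt f s‖ ≤ _
      refine (intervalIntegral.norm_integral_le_of_norm_le_const
        (fun s _ => mthExt_norm f s)).trans ?_
      rw [sub_zero, abs_of_nonneg x.2.1, mul_comm]
      exact mul_le_mul_of_nonneg_right x.2.2 (norm_nonneg _))

theorem mthV_apply (f : MthX) (x : Set.Icc (0 : ℝ) (Real.pi / 2)) : mthV f x = mthInt f x := rfl

theorem mthV_bound (f : MthX) (C : ℝ) (n : ℕ)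
    (h : ∀ x, ‖f x‖ ≤ C * (x : ℝ) ^ n) (x : Set.Icc (0 : ℝ) (Real.pi / 2)) :
    ‖mthV f x‖ ≤ C / (n + 1) * (x : ℝ) ^ (n + 1) := by
  rw [mthV_apply, mthInt]
  have : ‖∫ s in (0 : ℝ)..x, mthExt f s‖ ≤ ∫ s in (0 : ℝ)..x, C * s ^ n := by
    refine intervalIntegral.norm_integral_le_of_norm_le x.2.1 ?_ ?_
    · refine Filter.Eventually.of_forall fun s hs => ?_
      have hs' : s ∈ Set.Icc (0 : ℝ) (Real.pi / 2) := ⟨hs.1.le, hs.2.trans x.2.2⟩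
      rw [mthExt_of_mem f hs']
      exact h ⟨s, hs'⟩
    · exact (by fun_prop : Continuous fun s : ℝ => C * s ^ n).intervalIntegrable _ _
  refine this.trans (le_of_eq ?_)
  rw [intervalIntegral.integral_const_mul, integral_pow]
  simp
  ring

def mthMul (q : MthX) : MthX →L[ℂ] MthX := ContinuousLinearMap.mul ℂ MthX q

def mthA (q : MthX) (l : ℂ) : MthX →L[ℂ] MthX :=
  mthV * mthV * (mthMul q - l • (1 : MthX →L[ℂ] MthX))

theorem mthA_apply (q : MthX) (l : ℂ) (f : MthX) :
    mthA q l f = mthV (mthV (q * f - l • f)) := rfl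

theorem mthA_pow_bound (q : MthX) (l : ℂ) (f : MthX) (n : ℕ) :
    ∀ x : Set.Icc (0 : ℝ) (Real.pi / 2), ‖(mthA q l ^ n) f x‖ ≤
      (‖q‖ + ‖l‖) ^ n * ‖f‖ / (2 * n).factorial * (x : ℝ) ^ (2 * n) := by
  induction n with
  | zero => intro x; simpa using f.norm_coe_le_norm x
  | succ n ih =>
    intro x
    rw [pow_succ', mul_apply_eq_comp, mthA_apply]
    set g := (mthA q l ^ n) f
    have h1 : ∀ x : Set.Icc (0 : ℝ) (Real.pi / 2), ‖(q * g - l • g) x‖ ≤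
        ((‖q‖ + ‖l‖) * ((‖q‖ + ‖l‖) ^ n * ‖f‖ / (2 * n).factorial)) * (x : ℝ) ^ (2 * n) := by
      intro x
      have e : (q * g - l • g) x = (q x - l) * g x := by
        simp; ring
      rw [e, norm_mul, mul_assoc]
      refine mul_le_mul ((norm_sub_le _ _).trans ?_) (ih x) (norm_nonneg _) (by positivity)
      gcongr
      exact q.norm_coe_le_norm x
    have h2 := mthV_bound _ _ _ (mthV_bound _ _ _ h1) x
    refine h2.trans (le_of_eq ?_)
    rw [show 2 * (n + 1) = 2 * n + 1 + 1 by ring, Nat.factorial_succ, Nat.factorial_succ]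
    push_cast
    field_simp
    ring

theorem mth_gen_unit {B : Type*} [NormedRing B] [CompleteSpace B] (a : B) (n : ℕ)
    (hn : ‖a ^ n‖ < 1) : IsUnit (1 - a) := by
  have h1 : IsUnit (1 - a ^ n) := isUnit_one_sub_of_norm_lt_one hn
  have h2 := (Commute.one_left a).mul_geom_sum₂ n
  have h3 : Commute (1 - a) (∑ i ∈ Finset.range n, 1 ^ i * a ^ (n - 1 - i)) := by
    refine Commute.sum_right _ _ _ fun i _ => ?_
    rw [one_pow, one_mul]
    exact (Commute.sub_left (Commute.one_left _) (Commute.refl _)).pow_right _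
  rw [one_pow] at h2
  rw [← h2] at h1
  exact (h3.isUnit_mul_iff.1 h1).1

theorem mth_gen_diff {B : Type*} [NormedRing B] [NormedAlgebra ℂ B] [CompleteSpace B] (v m : B)
    (h : ∀ l : ℂ, IsUnit (1 - v * (m - l • (1 : B)))) :
    Differentiable ℂ fun l : ℂ => Ring.inverse (1 - v * (m - l • (1 : B))) := by
  intro l
  have h1 : DifferentiableAt ℂ (fun l : ℂ => 1 - v * (m - l • (1 : B))) l := by
    fun_prop
  exact DifferentiableAt.comp l (differentiableAt_inverse (𝕜 := ℂ) (h l)) h1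

theorem mthA_unit (q : MthX) (l : ℂ) : IsUnit (1 - mthA q l) := by
  obtain ⟨n, hn⟩ : ∃ n : ℕ, ‖mthA q l ^ n‖ < 1 := by
    have hb : ∀ n : ℕ, ‖mthA q l ^ n‖ ≤
        ((‖q‖ + ‖l‖) * (Real.pi / 2) ^ 2) ^ n / n.factorial := by
      intro n
      refine ContinuousLinearMap.opNorm_le_bound _ (by positivity) fun f => ?_
      rw [ContinuousMap.norm_le _ (by positivity)]
      intro x
      refine (mthA_pow_bound q l f n x).trans ?_
      have hx : (x : ℝ) ^ (2 * n) ≤ (Real.pi / 2) ^ (2 * n) :=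
        pow_le_pow_left₀ x.2.1 x.2.2 _
      have hf : (n.factorial : ℝ) ≤ (2 * n).factorial := by
        exact_mod_cast Nat.factorial_le (by omega)
      have hf0 : (0 : ℝ) < n.factorial := by exact_mod_cast Nat.factorial_pos n
      calc _ ≤ (‖q‖ + ‖l‖) ^ n * ‖f‖ / n.factorial * (Real.pi / 2) ^ (2 * n) := by
              gcongr
              exact pow_nonneg x.2.1 _
        _ = _ := by rw [mul_pow, ← pow_mul]; ring
    have ht := FloorSemiring.tendsto_pow_div_factorial_atTop ((‖q‖ + ‖l‖) * (Real.pi / 2) ^ 2)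
    obtain ⟨n, hn⟩ := (ht.eventually (gt_mem_nhds one_pos)).exists
    exact ⟨n, (hb n).trans_lt hn⟩
  exact mth_gen_unit (mthA q l) n hn

def mthR (q : MthX) (l : ℂ) : MthX →L[ℂ] MthX := Ring.inverse (1 - mthA q l)

theorem mthR_differentiable (q : MthX) : Differentiable ℂ (mthR q) := by
  exact mth_gen_diff (mthV * mthV) (mthMul q) (mthA_unit q)

theorem mthR_eq (q : MthX) (l : ℂ) {f g : MthX} (h : f - mthA q l f = g) : f = mthR q l g := by
  rw [← h]
  have := Ring.inverse_mul_cancel _ (mthA_unit q l)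
  have h2 := congrArg (fun T : MthX →L[ℂ] MthX => T f) this
  exact h2.symm

theorem mthR_spec (q : MthX) (l : ℂ) (g : MthX) :
    mthR q l g = g + mthV (mthV (q * mthR q l g - l • mthR q l g)) := by
  have := Ring.mul_inverse_cancel _ (mthA_unit q l)
  have h2 := congrArg (fun T : MthX →L[ℂ] MthX => T g) this
  have h3 : mthR q l g - mthA q l (mthR q l g) = g := h2
  rw [mthA_apply] at h3
  rw [← sub_eq_iff_eq_add]; exact h3

/-- fundamental solution with data `(a, b)`, and its derivative -/
def mthSol (q : MthX) (l a b : ℂ) : MthX := mthR q l (a • 1 + b • mthV 1)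

def mthSol' (q : MthX) (l a b : ℂ) : MthX :=
  b • 1 + mthV (q * mthSol q l a b - l • mthSol q l a b)

theorem mthSol_eq (q : MthX) (l a b : ℂ) :
    mthSol q l a b = a • 1 + mthV (mthSol' q l a b) := by
  rw [mthSol', map_add, map_smul, ← add_assoc]
  exact mthR_spec q l _

def mthEnd : Set.Icc (0 : ℝ) (Real.pi / 2) := ⟨Real.pi / 2, mth_L, le_rfl⟩

theorem mthSol_lin (q : MthX) (l a b : ℂ) :
    mthSol q l a b = a • mthSol q l 1 0 + b • mthSol q l 0 1 := by
  simp only [mthSol, map_add, map_smul]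
  ext x
  simp

theorem mthSol'_lin (q : MthX) (l a b : ℂ) :
    mthSol' q l a b = a • mthSol' q l 1 0 + b • mthSol' q l 0 1 := by
  rw [mthSol', mthSol_lin]
  have : q * (a • mthSol q l 1 0 + b • mthSol q l 0 1)
      - l • (a • mthSol q l 1 0 + b • mthSol q l 0 1) =
      a • (q * mthSol q l 1 0 - l • mthSol q l 1 0)
      + b • (q * mthSol q l 0 1 - l • mthSol q l 0 1) := by
    ext x; simp; ring
  rw [this]
  simp only [mthSol', map_add, map_smul]
  ext x
  simp only [ContinuousMap.add_apply, ContinuousMap.smul_apply, smul_eq_mul]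
  ring

theorem mthSol_unique (q : MthX) (l : ℂ) (y z : ℝ → ℂ)
    (hy : ∀ x ∈ Set.Icc (0 : ℝ) (Real.pi / 2), HasDerivAt y (z x) x)
    (hz : ∀ x ∈ Set.Icc (0 : ℝ) (Real.pi / 2), HasDerivAt z ((mthExt q x - l) * y x) x) :
    ∀ x (hx : x ∈ Set.Icc (0 : ℝ) (Real.pi / 2)), y x = mthSol q l (y 0) (z 0) ⟨x, hx⟩ ∧
      z x = mthSol' q l (y 0) (z 0) ⟨x, hx⟩ := by
  let Y : MthX := ⟨fun x => y x, by
    exact continuousOn_iff_continuous_domRestrict.1 (fun x hx =>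
      (hy x hx).continuousAt.continuousWithinAt : ContinuousOn y _)⟩
  let Z : MthX := ⟨fun x => z x, by
    exact continuousOn_iff_continuous_domRestrict.1 (fun x hx =>
      (hz x hx).continuousAt.continuousWithinAt : ContinuousOn z _)⟩
  have key : ∀ (u : ℝ → ℂ) (G : MthX), (∀ x ∈ Set.Icc (0 : ℝ) (Real.pi / 2),
      HasDerivAt u (mthExt G x) x) → ∀ x ∈ Set.Icc (0 : ℝ) (Real.pi / 2),
      u x = u 0 + mthInt G x := by
    intro u G h x hx
    have := intervalIntegral.integral_eq_sub_of_hasDerivAt (a := 0) (b := x) (f := u)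
      (f' := mthExt G) (fun s hs => h s (by
        rw [Set.uIcc_of_le hx.1] at hs
        exact ⟨hs.1, hs.2.trans hx.2⟩)) ((mthExt_cont G).intervalIntegrable _ _)
    rw [mthInt, this]; ring
  have hZ : Z = z 0 • 1 + mthV (q * Y - l • Y) := by
    ext x
    have := key z (q * Y - l • Y) (fun s hs => by
      refine (hz s hs).congr_deriv ?_
      rw [mthExt_of_mem _ hs, mthExt_of_mem _ hs]
      change _ = q _ * y s - l * y s; ring) x x.2
    rw [ContinuousMap.add_apply, mthV_apply]
    change z x = _
    simpa using this
  have hY : Y = y 0 • 1 + mthV Z := by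
    ext x
    have := key y Z (fun s hs => by
      refine (hy s hs).congr_deriv ?_
      rw [mthExt_of_mem _ hs]
      rfl) x x.2
    rw [ContinuousMap.add_apply, mthV_apply]
    change y x = _
    simpa using this
  have h1 : Y = mthSol q l (y 0) (z 0) := by
    refine mthR_eq q l ?_
    rw [mthA_apply, sub_eq_iff_eq_add, add_assoc, ← map_smul mthV, ← map_add mthV, ← hZ, ← hY]
  intro x hx
  refine ⟨congrArg (fun f : MthX => f ⟨x, hx⟩) h1, ?_⟩
  rw [mthSol', ← h1, ← hZ]; rfl

/-- global extensions of the solutions -/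
theorem mthSol_exists (q : MthX) (l a b : ℂ) : ∃ y z : ℝ → ℂ, y 0 = a ∧ z 0 = b ∧
    (∀ x ∈ Set.Icc (0 : ℝ) (Real.pi / 2), HasDerivAt y (z x) x) ∧
    (∀ x ∈ Set.Icc (0 : ℝ) (Real.pi / 2), HasDerivAt z ((mthExt q x - l) * y x) x) ∧
    y (Real.pi / 2) = mthSol q l a b mthEnd ∧ z (Real.pi / 2) = mthSol' q l a b mthEnd := by
  have hz : ∀ x (hx : x ∈ Set.Icc (0 : ℝ) (Real.pi / 2)),
      b + mthInt (q * mthSol q l a b - l • mthSol q l a b) x = mthSol' q l a b ⟨x, hx⟩ := by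
    intro x hx
    rw [mthSol', ContinuousMap.add_apply, mthV_apply]
    simp
  have hy : ∀ x (hx : x ∈ Set.Icc (0 : ℝ) (Real.pi / 2)),
      a + mthInt (mthSol' q l a b) x = mthSol q l a b ⟨x, hx⟩ := by
    intro x hx
    rw [mthSol_eq, ContinuousMap.add_apply, mthV_apply]
    simp
  refine ⟨fun x => a + mthInt (mthSol' q l a b) x,
    fun x => b + mthInt (q * mthSol q l a b - l • mthSol q l a b) x, ?_, ?_, ?_, ?_, ?_, ?_⟩
  · simp [mthInt]
  · simp [mthInt]
  · intro x hx
    beta_reduce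
    rw [hz x hx, ← mthExt_of_mem _ hx]
    exact (mthInt_deriv _ x).const_add _
  · intro x hx
    beta_reduce
    rw [hy x hx]
    refine ((mthInt_deriv _ x).const_add b).congr_deriv ?_
    rw [mthExt_of_mem _ hx, mthExt_of_mem _ hx]
    simp; ring
  · exact hy _ mthEnd.2
  · exact hz _ mthEnd.2

def mthM (q : MthX) (l : ℂ) : Matrix (Fin 2) (Fin 2) ℂ :=
  !![mthSol q l 1 0 mthEnd, mthSol q l 0 1 mthEnd; mthSol' q l 1 0 mthEnd, mthSol' q l 0 1 mthEnd]

theorem mthM_transfer (q : MthX) (l : ℂ) (y z : ℝ → ℂ)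
    (hy : ∀ x ∈ Set.Icc (0 : ℝ) (Real.pi / 2), HasDerivAt y (z x) x)
    (hz : ∀ x ∈ Set.Icc (0 : ℝ) (Real.pi / 2), HasDerivAt z ((mthExt q x - l) * y x) x) :
    ![y (Real.pi / 2), z (Real.pi / 2)] = (mthM q l).mulVec ![y 0, z 0] := by
  obtain ⟨h1, h2⟩ := mthSol_unique q l y z hy hz _ mthEnd.2
  rw [mthSol_lin] at h1
  rw [mthSol'_lin] at h2
  ext i
  fin_cases i
  · simp [mthM, Matrix.mulVec, dotProduct, Fin.sum_univ_two]
    erw [h1]; simp [mthEnd, mul_comm]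
  · simp [mthM, Matrix.mulVec, dotProduct, Fin.sum_univ_two]
    erw [h2]; simp [mthEnd, mul_comm]

theorem mthM_det (q : MthX) (l : ℂ) : (mthM q l).det = 1 := by
  obtain ⟨y, z, hy0, hz0, hy, hz, hy1, hz1⟩ := mthSol_exists q l 1 0
  obtain ⟨u, v, hu0, hv0, hu, hv, hu1, hv1⟩ := mthSol_exists q l 0 1
  have hW : ∀ x ∈ Set.Icc (0 : ℝ) (Real.pi / 2),
      HasDerivAt (fun x => y x * v x - u x * z x) 0 x := by
    intro x hx
    have h := ((hy x hx).mul (hv x hx)).sub ((hu x hx).mul (hz x hx))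
    refine h.congr_deriv ?_
    ring
  have := constant_of_has_deriv_right_zero
    (fun x hx => (hW x hx).continuousAt.continuousWithinAt)
    (fun x hx => (hW x ⟨hx.1, hx.2.le⟩).hasDerivWithinAt) _ mthEnd.2
  simp only [mthEnd] at this
  rw [hy0, hz0, hu0, hv0, hy1, hz1, hu1, hv1] at this
  rw [Matrix.det_fin_two]
  simpa [mthM] using this

theorem mthM_conj (q : MthX) (l : ℂ) :
    mthM (star q) (star l) = (mthM q l).map star := by
  have key : ∀ a b : ℂ, (mthSol (star q) (star l) (star a) (star b) mthEnd
      = star (mthSol q l a b mthEnd)) ∧ (mthSol' (star q) (star l) (star a) (star b) mthEnd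
      = star (mthSol' q l a b mthEnd)) := by
    intro a b
    obtain ⟨y, z, hy0, hz0, hy, hz, hy1, hz1⟩ := mthSol_exists q l a b
    obtain ⟨h1, h2⟩ := mthSol_unique (star q) (star l) (fun x => star (y x)) (fun x => star (z x))
      (fun x hx => (hy x hx).star) (fun x hx => by
        refine (hz x hx).star.congr_deriv ?_
        rw [mthExt_of_mem _ hx, mthExt_of_mem _ hx]
        simp) _ mthEnd.2
    rw [← hy1, ← hz1, ← hy0, ← hz0]
    exact ⟨h1.symm, h2.symm⟩
  have h10 := key 1 0
  have h01 := key 0 1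
  simp only [star_one, star_zero] at h10 h01
  ext i j
  fin_cases i <;> fin_cases j
  · exact h10.1
  · exact h01.1
  · exact h10.2
  · exact h01.2

theorem mthM_differentiable (q : MthX) (i j : Fin 2) :
    Differentiable ℂ (fun l => mthM q l i j) := by
  have hS : ∀ a b : ℂ, Differentiable ℂ (fun l => mthSol q l a b) := by
    intro a b
    exact (mthR_differentiable q).clm_apply (differentiable_const _)
  have hS' : ∀ a b : ℂ, Differentiable ℂ (fun l => mthSol' q l a b) := by
    intro a b
    have := hS a b
    unfold mthSol'
    fun_prop
  have hev : ∀ f : ℂ → MthX, Differentiable ℂ f → Differentiable ℂ fun l => f l mthEnd := by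
    intro f hf
    exact (ContinuousMap.evalCLM ℂ mthEnd).differentiable.comp hf
  fin_cases i <;> fin_cases j
  · exact hev _ (hS 1 0)
  · exact hev _ (hS 0 1)
  · exact hev _ (hS' 1 0)
  · exact hev _ (hS' 0 1)


theorem mthM_zero (q : MthX) (l : ℂ) (y z : ℝ → ℂ)
    (hy : ∀ x ∈ Set.Icc (0 : ℝ) (Real.pi / 2), HasDerivAt y (z x) x)
    (hz : ∀ x ∈ Set.Icc (0 : ℝ) (Real.pi / 2), HasDerivAt z ((mthExt q x - l) * y x) x)
    (hy0 : y 0 = 0) (hz0 : z 0 = 0) :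
    ∀ x ∈ Set.Icc (0 : ℝ) (Real.pi / 2), y x = 0 ∧ z x = 0 := by
  intro x hx
  obtain ⟨h1, h2⟩ := mthSol_unique q l y z hy hz x hx
  rw [h1, h2, hy0, hz0, mthSol_lin, mthSol'_lin]
  simp

def mthQ (c : ℝ) : MthX :=
  ⟨fun x => 2 * Complex.I * (c : ℂ) * Complex.cos (2 * ((x : ℝ) : ℂ)), by fun_prop⟩

def mthF (c : ℝ) (l : ℂ) : ℂ := (mthM (star (mthQ c)) l * mthM (mthQ c) l).trace

theorem mthF_differentiable (c : ℝ) : Differentiable ℂ (mthF c) := by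
  unfold mthF
  simp only [Matrix.trace_fin_two, Matrix.mul_apply, Fin.sum_univ_two]
  have h1 := mthM_differentiable (mthQ c)
  have h2 := mthM_differentiable (star (mthQ c))
  exact (((h2 0 0).mul (h1 0 0)).add ((h2 0 1).mul (h1 1 0))).add
    (((h2 1 0).mul (h1 0 1)).add ((h2 1 1).mul (h1 1 1)))

theorem mthF_real (c : ℝ) (x : ℝ) : (mthF c (x : ℂ)).im = 0 := by
  have h := mthM_conj (mthQ c) (x : ℂ)
  have hx : star (x : ℂ) = x := Complex.conj_ofReal x
  rw [hx] at h
  rw [mthF, h]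
  simp only [Matrix.trace_fin_two, Matrix.mul_apply, Fin.sum_univ_two, Matrix.map_apply]
  simp
  ring

theorem mthF_eigen (c t : ℝ) (l : ℂ) (y : ℝ → ℂ) (hy : ContDiff ℝ 2 y)
    (hne : ∃ x ∈ Set.Icc (0 : ℝ) Real.pi, y x ≠ 0)
    (hode : ∀ x ∈ Set.Icc (0 : ℝ) Real.pi,
      -(deriv (deriv y) x) + 2 * Complex.I * (c : ℂ) * Complex.cos (2 * (x : ℂ)) * y x
        = l * y x)
    (hb : y Real.pi = Complex.exp (Complex.I * (Real.pi : ℂ) * (t : ℂ)) * y 0)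
    (hb' : deriv y Real.pi = Complex.exp (Complex.I * (Real.pi : ℂ) * (t : ℂ)) * deriv y 0) :
    mthF c l = ((2 * Real.cos (Real.pi * t) : ℝ) : ℂ) := by
  have hpi := Real.pi_pos
  have d1 : ∀ x, HasDerivAt y (deriv y x) x := fun x =>
    ((hy.differentiable (by norm_num)) x).hasDerivAt
  have hy' : ContDiff ℝ 1 (deriv y) := by
    have : ContDiff ℝ (1 + 1) y := by simpa [one_add_one_eq_two] using hy
    exact (contDiff_succ_iff_deriv.1 this).2.2
  have d2 : ∀ x, HasDerivAt (deriv y) (deriv (deriv y) x) x := fun x =>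
    ((hy'.differentiable (by norm_num)) x).hasDerivAt
  have A1 : ∀ x ∈ Set.Icc (0 : ℝ) (Real.pi / 2),
      HasDerivAt (deriv y) ((mthExt (mthQ c) x - l) * y x) x := by
    intro x hx
    refine (d2 x).congr_deriv ?_
    rw [mthExt_of_mem _ hx]
    have := hode x ⟨hx.1, by linarith [hx.2]⟩
    change _ = (2 * Complex.I * (c : ℂ) * Complex.cos (2 * (x : ℂ)) - l) * y x
    linear_combination -this
  have B1 : ∀ x ∈ Set.Icc (0 : ℝ) (Real.pi / 2),
      HasDerivAt (fun x => y (x + Real.pi / 2)) (deriv y (x + Real.pi / 2)) x := fun x _ =>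
    (d1 (x + Real.pi / 2)).comp_add_const x (Real.pi / 2)
  have B2 : ∀ x ∈ Set.Icc (0 : ℝ) (Real.pi / 2),
      HasDerivAt (fun x => deriv y (x + Real.pi / 2))
        ((mthExt (star (mthQ c)) x - l) * y (x + Real.pi / 2)) x := by
    intro x hx
    refine ((d2 (x + Real.pi / 2)).comp_add_const x (Real.pi / 2)).congr_deriv ?_
    rw [mthExt_of_mem _ hx]
    have := hode (x + Real.pi / 2) ⟨by linarith [hx.1], by linarith [hx.2]⟩
    have e : Complex.cos (2 * ((x + Real.pi / 2 : ℝ) : ℂ)) = - Complex.cos (2 * (x : ℂ)) := by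
      rw [← Complex.cos_add_pi]; congr 1; push_cast; ring
    rw [e] at this
    have e2 : (star (mthQ c)) ⟨x, hx⟩ = -(2 * Complex.I * (c : ℂ) * Complex.cos (2 * (x : ℂ))) := by
      change star (2 * Complex.I * (c : ℂ) * Complex.cos (2 * (x : ℂ))) = _
      have : (2 * (x : ℂ)) = ((2 * x : ℝ) : ℂ) := by push_cast; rfl
      rw [this, ← Complex.ofReal_cos]
      simp [-Complex.ofReal_cos]
    rw [e2]
    linear_combination -this
  set m := Complex.exp (Complex.I * (Real.pi : ℂ) * (t : ℂ)) with hm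
  have T1 := mthM_transfer (mthQ c) l y (deriv y) (fun x _ => d1 x) A1
  have T2 := mthM_transfer (star (mthQ c)) l _ _ B1 B2
  rw [zero_add, add_halves, T1, Matrix.mulVec_mulVec] at T2
  set M := mthM (star (mthQ c)) l * mthM (mthQ c) l with hM
  have hdet : M.det = 1 := by rw [hM, Matrix.det_mul, mthM_det, mthM_det, one_mul]
  have hv : ![y 0, deriv y 0] ≠ 0 := by
    intro h0
    have h1 : y 0 = 0 := congrFun h0 0
    have h2 : deriv y 0 = 0 := congrFun h0 1
    have Z1 := mthM_zero (mthQ c) l y (deriv y) (fun x _ => d1 x) A1 h1 h2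
    have Z2 := mthM_zero (star (mthQ c)) l _ _ B1 B2
      (by simpa using (Z1 (Real.pi / 2) mthEnd.2).1) (by simpa using (Z1 (Real.pi / 2) mthEnd.2).2)
    obtain ⟨x, hx, hx0⟩ := hne
    rcases le_total x (Real.pi / 2) with h | h
    · exact hx0 (Z1 x ⟨hx.1, h⟩).1
    · apply hx0
      have := (Z2 (x - Real.pi / 2) ⟨by linarith, by linarith [hx.2]⟩).1
      simpa using this
  have hsing : (M - m • (1 : Matrix (Fin 2) (Fin 2) ℂ)).det = 0 := by
    refine Matrix.exists_mulVec_eq_zero_iff.1 ⟨_, hv, ?_⟩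
    rw [Matrix.sub_mulVec, ← T2, Matrix.smul_mulVec, Matrix.one_mulVec, hb, hb']
    ext i
    fin_cases i <;> simp
  rw [Matrix.det_fin_two] at hsing hdet
  simp at hsing
  have htr : M.trace * m = m * m + 1 := by
    rw [Matrix.trace_fin_two]
    linear_combination hdet - hsing
  have hm0 : m ≠ 0 := Complex.exp_ne_zero _
  change M.trace = _
  apply mul_right_cancel₀ hm0
  rw [htr]
  push_cast
  rw [Complex.two_cos]
  have e1 : Complex.exp (↑Real.pi * ↑t * Complex.I) = m := by rw [hm]; congr 1; ring
  have e2 : Complex.exp (-(↑Real.pi * ↑t) * Complex.I) * m = 1 := by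
    rw [hm, ← Complex.exp_add, ← Complex.exp_zero]; congr 1; ring
  rw [add_mul, e1, e2]

end MathieuAux

theorem mth_exp_one_const {C : Set ℂ} (hC : IsPreconnected C) (h : ℂ → ℂ) (hh : ContinuousOn h C)
    (he : ∀ z ∈ C, Complex.exp (h z) = 1) {u v : ℂ} (hu : u ∈ C) (hv : v ∈ C) : h u = h v := by
  have hcount : (Set.range fun n : ℤ => (n : ℂ) * (2 * Real.pi * Complex.I)).Countable :=
    Set.countable_range _
  refine hcount.isTotallyDisconnected (h '' C) ?_ (hC.image h hh) ⟨u, hu, rfl⟩ ⟨v, hv, rfl⟩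
  rintro _ ⟨z, hz, rfl⟩
  obtain ⟨n, hn⟩ := Complex.exp_eq_one_iff.1 (he z hz)
  exact ⟨n, hn.symm⟩

theorem mth_component_frontier {K : Set ℂ} (hK : IsClosed K) (p : ℂ) :
    frontier (connectedComponentIn Kᶜ p) ⊆ K := by
  intro z hz
  by_contra hzK
  have ho : IsOpen (connectedComponentIn Kᶜ p) := hK.isOpen_compl.connectedComponentIn
  have hoz : IsOpen (connectedComponentIn Kᶜ z) := hK.isOpen_compl.connectedComponentIn
  have hzz : z ∈ connectedComponentIn Kᶜ z := mem_connectedComponentIn hzK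
  rw [ho.frontier_eq] at hz
  obtain ⟨w, hw1, hw2⟩ := mem_closure_iff.1 hz.1 _ hoz hzz
  have e1 := connectedComponentIn_eq hw1
  have e2 := connectedComponentIn_eq hw2
  exact hz.2 (by rw [e2, ← e1]; exact hzz)

theorem mth_unbounded {K : Set ℂ} (hK : IsClosed K) (F : ℂ → ℂ) (hF : Differentiable ℂ F)
    (hR : ∀ z ∈ K, (F z).im = 0) (hnc : ¬ ∃ w, ∀ z, F z = w) {p : ℂ} (hp : p ∉ K) :
    ¬ Bornology.IsBounded (connectedComponentIn Kᶜ p) := by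
  intro hb
  have hsub := mth_component_frontier hK p
  have hpV : p ∈ connectedComponentIn Kᶜ p := mem_connectedComponentIn hp
  have ho : IsOpen (connectedComponentIn Kᶜ p) := hK.isOpen_compl.connectedComponentIn
  set V := connectedComponentIn Kᶜ p
  have key : ∀ s : ℝ, ∀ z ∈ V, -(s * (F z).im) ≤ 0 := by
    intro s z hz
    have hd : Differentiable ℂ fun z => Complex.exp ((s : ℂ) * Complex.I * F z) := by fun_prop
    have := Complex.norm_le_of_forall_mem_frontier_norm_le hb hd.diffContOnCl (C := 1)
      (fun w hw => by
        rw [Complex.norm_exp]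
        simp [hR w (hsub hw)]) (subset_closure hz)
    rw [Complex.norm_exp, Real.exp_le_one_iff] at this
    simpa using this
  have him : ∀ z ∈ V, (F z).im = 0 := by
    intro z hz
    have h1 := key 1 z hz
    have h2 := key (-1) z hz
    linarith
  have han : AnalyticOnNhd ℂ F Set.univ := fun z _ => hF.analyticAt z
  rcases han.is_constant_or_isOpenMap with h | h
  · exact hnc h
  · have h1 := h V ho
    have h2 : F p ∈ F '' V := ⟨p, hpV, rfl⟩
    obtain ⟨e, he, hball⟩ := Metric.isOpen_iff.1 h1 _ h2
    have h3 : F p + ((e / 2 : ℝ) : ℂ) * Complex.I ∈ Metric.ball (F p) e := by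
      rw [Metric.mem_ball, dist_eq_norm, add_sub_cancel_left, norm_mul, Complex.norm_I, mul_one,
        Complex.norm_real, Real.norm_eq_abs, abs_of_pos (by positivity)]
      linarith
    obtain ⟨w, hw, hw2⟩ := hball h3
    have h4 := him w hw
    rw [hw2] at h4
    simp [him p hpV] at h4
    exact he.ne' h4

def MthHasLog (K : Set ℂ) (p : ℂ) : Prop :=
  ∃ g : ℂ → ℂ, ContinuousOn g K ∧ ∀ z ∈ K, Complex.exp (g z) = z - p

theorem MthHasLog.move {K : Set ℂ} {p q : ℂ} (h : MthHasLog K p)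
    (hlt : ∀ z ∈ K, ‖p - q‖ < ‖z - p‖) : MthHasLog K q := by
  obtain ⟨g, hg, he⟩ := h
  have hne : ∀ z ∈ K, z - p ≠ 0 := fun z hz => by rw [← he z hz]; exact Complex.exp_ne_zero _
  have hsl : ∀ z ∈ K, 1 + (p - q) / (z - p) ∈ Complex.slitPlane := by
    intro z hz
    apply Complex.mem_slitPlane_of_norm_lt_one
    rw [norm_div, div_lt_one (norm_pos_iff.2 (hne z hz))]
    exact hlt z hz
  refine ⟨fun z => g z + Complex.log (1 + (p - q) / (z - p)), ?_, ?_⟩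
  · refine hg.add (ContinuousOn.clog ?_ hsl)
    exact continuousOn_const.add (continuousOn_const.div (by fun_prop) hne)
  · intro z hz
    rw [Complex.exp_add, he z hz, Complex.exp_log (Complex.slitPlane_ne_zero (hsl z hz))]
    have := hne z hz
    field_simp
    ring

theorem mth_hasLog_far {K : Set ℂ} {p : ℂ} (h : ∀ z ∈ K, ‖z‖ < ‖p‖) (hp : p ≠ 0) :
    MthHasLog K p := by
  have hsl : ∀ z ∈ K, 1 + (-z / p) ∈ Complex.slitPlane := by
    intro z hz
    apply Complex.mem_slitPlane_of_norm_lt_one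
    rw [norm_div, norm_neg, div_lt_one (norm_pos_iff.2 hp)]
    exact h z hz
  refine ⟨fun z => Complex.log (-p) + Complex.log (1 + (-z / p)), ?_, ?_⟩
  · refine continuousOn_const.add (ContinuousOn.clog ?_ hsl)
    fun_prop
  · intro z hz
    rw [Complex.exp_add, Complex.exp_log (neg_ne_zero.2 hp),
      Complex.exp_log (Complex.slitPlane_ne_zero (hsl z hz))]
    field_simp
    ring

theorem mth_hasLog {K : Set ℂ} (hK : IsCompact K) {p : ℂ} (hp : p ∉ K)
    (hub : ¬ Bornology.IsBounded (connectedComponentIn Kᶜ p)) : MthHasLog K p := by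
  have loc : ∀ q ∉ K, ∃ r > 0, ∀ q' ∈ Metric.ball q r, q' ∉ K ∧
      (MthHasLog K q ↔ MthHasLog K q') := by
    intro q hq
    obtain ⟨e, he, hball⟩ := Metric.isOpen_iff.1 hK.isClosed.isOpen_compl q hq
    refine ⟨e / 2, by positivity, fun q' hq' => ?_⟩
    have hd : ∀ z ∈ K, e ≤ ‖z - q‖ := by
      intro z hz
      by_contra hlt
      exact hball (by rw [Metric.mem_ball, dist_eq_norm]; exact not_le.1 hlt) hz
    rw [Metric.mem_ball, dist_eq_norm] at hq'
    have hd' : ∀ z ∈ K, e / 2 < ‖z - q'‖ := by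
      intro z hz
      have h1 := hd z hz
      have h2 : ‖z - q‖ ≤ ‖z - q'‖ + ‖q' - q‖ := norm_sub_le_norm_sub_add_norm_sub _ _ _
      linarith
    refine ⟨fun hK' => ?_, fun h => h.move fun z hz => ?_, fun h => h.move fun z hz => ?_⟩
    · have := hd' q' hK'
      simp at this
      linarith
    · rw [norm_sub_rev]
      linarith [hd z hz]
    · linarith [hd' z hz]
  have ho1 : IsOpen {q | q ∉ K ∧ MthHasLog K q} := by
    rw [Metric.isOpen_iff]
    rintro q ⟨hq, hl⟩
    obtain ⟨r, hr, h⟩ := loc q hq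
    exact ⟨r, hr, fun q' hq' => ⟨(h q' hq').1, (h q' hq').2.1 hl⟩⟩
  have ho2 : IsOpen {q | q ∉ K ∧ ¬ MthHasLog K q} := by
    rw [Metric.isOpen_iff]
    rintro q ⟨hq, hl⟩
    obtain ⟨r, hr, h⟩ := loc q hq
    exact ⟨r, hr, fun q' hq' => ⟨(h q' hq').1, fun hh => hl ((h q' hq').2.2 hh)⟩⟩
  obtain ⟨R, hR⟩ := hK.isBounded.exists_norm_le
  have hfar : ∃ q ∈ connectedComponentIn Kᶜ p, max R 0 < ‖q‖ := by
    by_contra hcon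
    push Not at hcon
    exact hub (isBounded_iff_forall_norm_le.2 ⟨_, hcon⟩)
  obtain ⟨q, hqV, hq⟩ := hfar
  have hsub := connectedComponentIn_subset Kᶜ p
  have hqL : MthHasLog K q := by
    refine mth_hasLog_far (fun z hz => (hR z hz).trans_lt ((le_max_left _ _).trans_lt hq)) ?_
    exact norm_pos_iff.1 ((le_max_right _ _).trans_lt hq)
  have := isPreconnected_connectedComponentIn.subset_left_of_subset_union ho1 ho2
    (by
      rw [Set.disjoint_left]
      rintro z ⟨_, h1⟩ ⟨_, h2⟩
      exact h2 h1)
    (fun z hz => by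
      by_cases h : MthHasLog K z
      · exact Or.inl ⟨hsub hz, h⟩
      · exact Or.inr ⟨hsub hz, h⟩)
    ⟨q, hqV, hsub hqV, hqL⟩
  exact (this (mem_connectedComponentIn hp)).2

theorem mth_wval (s e : ℝ) (he : 0 < e) :
    ((s : ℂ) - e * Complex.I) / ((s : ℂ) + e * Complex.I) =
      ⟨(s ^ 2 - e ^ 2) / (s ^ 2 + e ^ 2), -2 * s * e / (s ^ 2 + e ^ 2)⟩ := by
  have hpos : 0 < s ^ 2 + e ^ 2 := by positivity
  have hne : (s : ℂ) + e * Complex.I ≠ 0 := by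
    intro h
    have := congrArg Complex.im h
    simp at this
    exact he.ne' this
  rw [div_eq_iff hne]
  apply Complex.ext
  · simp
    field_simp
    ring
  · simp
    field_simp
    ring

theorem mth_loop (C : Set ℂ) (hCc : IsCompact C) (hCp : IsPreconnected C) (u₀ x u₁ : ℝ)
    (h0x : u₀ < x) (hx1 : x < u₁) (hu₀ : (u₀ : ℂ) ∈ C) (hu₁ : (u₁ : ℂ) ∈ C) (hx : (x : ℂ) ∉ C)
    (F : ℂ → ℂ) (hF : Differentiable ℂ F) (hR : ∀ y : ℝ, (F y).im = 0)
    (hCF : ∀ z ∈ C, (F z).im = 0) : ∃ w, ∀ z, F z = w := by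
  by_contra hnc
  set S : Set ℂ := Complex.ofReal '' Set.Icc u₀ u₁ with hS
  have hSc : IsCompact S := isCompact_Icc.image Complex.continuous_ofReal
  have hSp : IsPreconnected S := isPreconnected_Icc.image _ Complex.continuous_ofReal.continuousOn
  have hKc : IsCompact (C ∪ S) := hCc.union hSc
  have hKF : ∀ z ∈ C ∪ S, (F z).im = 0 := by
    rintro z (hz | ⟨y, _, rfl⟩)
    · exact hCF z hz
    · exact hR y
  obtain ⟨r, hr, hball⟩ := Metric.isOpen_iff.1 hCc.isClosed.isOpen_compl _ hx
  have hd : ∀ z ∈ C, r ≤ ‖z - x‖ := by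
    intro z hz
    by_contra hlt
    exact hball (by rw [Metric.mem_ball, dist_eq_norm]; exact not_le.1 hlt) hz
  obtain ⟨e, he, her⟩ : ∃ e : ℝ, 0 < e ∧ 4 * e = r := ⟨r / 4, by positivity, by ring⟩
  have hnotK : ∀ s : ℝ, |s| = e → (x : ℂ) + s * Complex.I ∉ C ∪ S := by
    rintro s hs (h | ⟨y, _, h⟩)
    · have := hd _ h
      simp [hs] at this
      linarith
    · have := congrArg Complex.im h
      simp at this
      rw [← this] at hs
      simp at hs
      exact he.ne hs
  have hlog : ∀ s : ℝ, |s| = e → MthHasLog (C ∪ S) ((x : ℂ) + s * Complex.I) := fun s hs =>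
    mth_hasLog hKc (hnotK s hs) (mth_unbounded hKc.isClosed F hF hKF hnc (hnotK s hs))
  obtain ⟨g1, hg1, he1⟩ := hlog e (abs_of_pos he)
  obtain ⟨g2, hg2, he2⟩ := hlog (-e) (by rw [abs_neg, abs_of_pos he])
  set w : ℂ → ℂ := fun z => (z - (x + (e : ℝ) * Complex.I)) / (z - (x + ((-e : ℝ) : ℂ) * Complex.I))
    with hw
  have hden : ∀ z ∈ C ∪ S, z - (x + ((-e : ℝ) : ℂ) * Complex.I) ≠ 0 := fun z hz => by
    rw [← he2 z hz]; exact Complex.exp_ne_zero _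
  have hnum : ∀ z ∈ C ∪ S, z - (x + ((e : ℝ) : ℂ) * Complex.I) ≠ 0 := fun z hz => by
    rw [← he1 z hz]; exact Complex.exp_ne_zero _
  have hexp : ∀ z ∈ C ∪ S, Complex.exp (g1 z - g2 z) = w z := by
    intro z hz
    rw [Complex.exp_sub, he1 z hz, he2 z hz]
  have hw0 : ∀ z ∈ C ∪ S, w z ≠ 0 := fun z hz => div_ne_zero (hnum z hz) (hden z hz)
  have hwc : ContinuousOn w (C ∪ S) := ContinuousOn.div (by fun_prop) (by fun_prop) hden
  have hwS : ∀ y : ℝ, w y = ⟨((y - x) ^ 2 - e ^ 2) / ((y - x) ^ 2 + e ^ 2),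
      -2 * (y - x) * e / ((y - x) ^ 2 + e ^ 2)⟩ := by
    intro y
    rw [← mth_wval (y - x) e he, hw]
    push_cast
    congr 1 <;> ring
  -- on `C`
  have hslC : ∀ z ∈ C, w z ∈ Complex.slitPlane := by
    intro z hz
    have hz0 := hden z (Or.inl hz)
    have e1 : w z = 1 + (-(2 * e * Complex.I)) / (z - (x + ((-e : ℝ) : ℂ) * Complex.I)) := by
      rw [hw]
      beta_reduce
      rw [div_eq_iff hz0, add_mul, div_mul_cancel₀ _ hz0]
      push_cast
      ring
    rw [e1]
    apply Complex.mem_slitPlane_of_norm_lt_one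
    rw [norm_div, div_lt_one (norm_pos_iff.2 hz0)]
    have h1 : ‖-(2 * (e : ℂ) * Complex.I)‖ = 2 * e := by
      simp [abs_of_pos he]
    have h2 := hd z hz
    have h3 : ‖z - x‖ ≤ ‖z - (x + ((-e : ℝ) : ℂ) * Complex.I)‖ + e := by
      have h4 : z - x = (z - (x + ((-e : ℝ) : ℂ) * Complex.I)) + ((-e : ℝ) : ℂ) * Complex.I := by
        ring
      calc ‖z - x‖ = ‖(z - (x + ((-e : ℝ) : ℂ) * Complex.I)) + ((-e : ℝ) : ℂ) * Complex.I‖ := by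
            rw [← h4]
        _ ≤ _ := norm_add_le _ _
        _ = _ := by
          congr 1
          simp [abs_of_pos he]
    rw [h1]
    linarith
  have hC := mth_exp_one_const hCp (fun z => g1 z - g2 z - Complex.log (w z))
    (((hg1.sub hg2).mono Set.subset_union_left).sub
      ((hwc.mono Set.subset_union_left).clog hslC))
    (fun z hz => by
      rw [Complex.exp_sub, hexp z (Or.inl hz), Complex.exp_log (hw0 z (Or.inl hz)),
        div_self (hw0 z (Or.inl hz))]) hu₀ hu₁
  -- on the segment
  have hslS : ∀ z ∈ S, -w z ∈ Complex.slitPlane := by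
    rintro _ ⟨y, hy, rfl⟩
    rw [hwS y, Complex.mem_slitPlane_iff]
    by_cases hyx : y - x = 0
    · left
      rw [hyx]
      simp
      rw [neg_div, div_self (by positivity)]
      norm_num
    · right
      simp only [Complex.neg_im, ne_eq, neg_eq_zero]
      have : (y - x) ^ 2 + e ^ 2 ≠ 0 := by positivity
      simp [hyx, this, he.ne']
  have hSS := mth_exp_one_const hSp
    (fun z => g1 z - g2 z - Complex.log (-w z) - Real.pi * Complex.I)
    ((((hg1.sub hg2).mono Set.subset_union_right).sub
      ((hwc.mono Set.subset_union_right).neg.clog hslS)).sub continuousOn_const)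
    (fun z hz => by
      rw [Complex.exp_sub, Complex.exp_sub, hexp z (Or.inr hz),
        Complex.exp_log (neg_ne_zero.2 (hw0 z (Or.inr hz))), Complex.exp_pi_mul_I]
      have := hw0 z (Or.inr hz)
      field_simp)
    (u := (u₀ : ℂ)) (v := (u₁ : ℂ)) ⟨u₀, ⟨le_rfl, by linarith⟩, rfl⟩ ⟨u₁, ⟨by linarith, le_rfl⟩, rfl⟩
  have i0 : 0 < (w u₀).im := by
    rw [hwS]
    have h1 : 0 < x - u₀ := by linarith
    refine div_pos ?_ (by positivity)
    nlinarith [mul_pos h1 he]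
  have i1 : (w u₁).im < 0 := by
    rw [hwS]
    have h1 : 0 < u₁ - x := by linarith
    refine div_neg_of_neg_of_pos ?_ (by positivity)
    nlinarith [mul_pos h1 he]
  have a0 := Complex.arg_neg_eq_arg_sub_pi_of_im_pos i0
  have a1 := Complex.arg_neg_eq_arg_add_pi_of_im_neg i1
  have hC' := congrArg Complex.im hC
  have hS' := congrArg Complex.im hSS
  simp only [Complex.sub_im, Complex.log_im] at hC' hS'
  rw [a0, a1] at hS'
  linarith [Real.pi_pos]

theorem mth_no_return (F : ℂ → ℂ) (hF : Differentiable ℂ F) (hR : ∀ y : ℝ, (F y).im = 0)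
    (γ : ℝ → ℂ) (a b : ℝ) (hab : a ≤ b) (hγ : ContinuousOn γ (Set.Icc a b))
    (hγF : ∀ t ∈ Set.Icc a b, (F (γ t)).im = 0)
    (hint : ∀ t ∈ Set.Ioo a b, (γ t).im ≠ 0) (ha : (γ a).im = 0) (hb : (γ b).im = 0)
    (hne : γ a ≠ γ b) : ∃ w, ∀ z, F z = w := by
  have ea : γ a = ((γ a).re : ℂ) := Complex.ext rfl ha
  have eb : γ b = ((γ b).re : ℂ) := Complex.ext rfl hb
  have hre : (γ a).re ≠ (γ b).re := fun h => hne (by rw [ea, eb, h])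
  have hCc : IsCompact (γ '' Set.Icc a b) := isCompact_Icc.image_of_continuousOn hγ
  have hCp : IsPreconnected (γ '' Set.Icc a b) := isPreconnected_Icc.image _ hγ
  have ma : ((γ a).re : ℂ) ∈ γ '' Set.Icc a b := ⟨a, ⟨le_rfl, hab⟩, ea⟩
  have mb : ((γ b).re : ℂ) ∈ γ '' Set.Icc a b := ⟨b, ⟨hab, le_rfl⟩, eb⟩
  have hCF : ∀ z ∈ γ '' Set.Icc a b, (F z).im = 0 := by
    rintro _ ⟨t, ht, rfl⟩
    exact hγF t ht
  have hmid : ∀ x : ℝ, x ≠ (γ a).re → x ≠ (γ b).re → (x : ℂ) ∉ γ '' Set.Icc a b := by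
    rintro x h1 h2 ⟨t, ht, h⟩
    rcases eq_or_lt_of_le ht.1 with h3 | h3
    · subst h3; rw [h] at h1; exact h1 rfl
    · rcases eq_or_lt_of_le ht.2 with h4 | h4
      · subst h4; rw [h] at h2; exact h2 rfl
      · exact hint t ⟨h3, h4⟩ (by rw [h]; simp)
  rcases lt_or_gt_of_ne hre with h | h
  · obtain ⟨x, h1, h2⟩ := exists_between h
    exact mth_loop _ hCc hCp _ x _ h1 h2 ma mb (hmid x h1.ne' h2.ne) F hF hR hCF
  · obtain ⟨x, h1, h2⟩ := exists_between h
    exact mth_loop _ hCc hCp _ x _ h1 h2 mb ma (hmid x h2.ne h1.ne') F hF hR hCF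

/-- If `d ∈ [0,1)` is the greatest number such that the Bloch eigenvalue `λ(t)`
is real for all `t ∈ [0,d]`, then `λ(t)` is nonreal for all `t ∈ (d,1]`. -/
theorem stmt3 (c : ℝ) (hc : 0 < c) (lam : ℝ → ℂ)
    (hcont : ContinuousOn lam (Set.Icc 0 1))
    (hev : ∀ t ∈ Set.Icc (0 : ℝ) 1, mathieuEV c t (lam t))
    (d : ℝ) (hd : d ∈ Set.Ico (0 : ℝ) 1)
    (hreal : ∀ t ∈ Set.Icc 0 d, (lam t).im = 0)
    (hgreatest : ∀ δ > (0 : ℝ), ∃ t, d < t ∧ t ≤ min (d + δ) 1 ∧ (lam t).im ≠ 0) :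
    ∀ t ∈ Set.Ioc d 1, (lam t).im ≠ 0 := by
  intro t₀ ht₀ h₀
  obtain ⟨t₁, h1d, h1, h1im⟩ := hgreatest (t₀ - d) (sub_pos.2 ht₀.1)
  have h10 : t₁ ≤ t₀ := by
    have := h1.trans (min_le_left _ _)
    linarith
  have hFe : ∀ t ∈ Set.Icc (0 : ℝ) 1,
      mthF c (lam t) = ((2 * Real.cos (Real.pi * t) : ℝ) : ℂ) := by
    intro t ht
    obtain ⟨y, hy, hne, hode, hb, hb'⟩ := hev t ht
    exact mthF_eigen c t (lam t) y hy hne hode hb hb'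
  have hcomp : ∀ u v : ℝ, 0 ≤ u → v ≤ 1 →
      IsCompact {t | t ∈ Set.Icc u v ∧ (lam t).im = 0} := by
    intro u v hu hv
    have hcon : ContinuousOn (fun t => (lam t).im) (Set.Icc u v) :=
      Complex.continuous_im.comp_continuousOn (hcont.mono (Set.Icc_subset_Icc hu hv))
    have hcl : IsClosed (Set.Icc u v ∩ (fun t => (lam t).im) ⁻¹' {0}) :=
      hcon.preimage_isClosed_of_isClosed isClosed_Icc isClosed_singleton
    exact isCompact_Icc.of_isClosed_subset hcl Set.inter_subset_left
  have hd0 := hd.1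
  have ht1 := ht₀.2
  obtain ⟨a, ⟨haI, ha⟩, hamax⟩ := (hcomp d t₁ hd0 (by linarith)).exists_isGreatest
    ⟨d, ⟨le_rfl, h1d.le⟩, hreal d ⟨hd0, le_rfl⟩⟩
  obtain ⟨b, ⟨hbI, hb⟩, hbmin⟩ := (hcomp t₁ t₀ (by linarith) ht1).exists_isLeast
    ⟨t₀, ⟨h10, le_rfl⟩, h₀⟩
  have hab : a < b := by
    rcases lt_or_eq_of_le (haI.2.trans hbI.1) with h | h
    · exact h
    · exfalso
      have : a = t₁ := le_antisymm haI.2 (by rw [h]; exact hbI.1)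
      exact h1im (this ▸ ha)
  have hIcc : Set.Icc a b ⊆ Set.Icc 0 1 :=
    Set.Icc_subset_Icc (hd0.trans haI.1) (hbI.2.trans ht1)
  have hcosinj : ∀ u ∈ Set.Icc (0 : ℝ) 1, ∀ v ∈ Set.Icc (0 : ℝ) 1, u < v →
      mthF c (lam u) ≠ mthF c (lam v) := by
    intro u hu v hv huv h
    rw [hFe u hu, hFe v hv, Complex.ofReal_inj] at h
    have hpi := Real.pi_pos
    have := Real.cos_lt_cos_of_nonneg_of_le_pi (x := Real.pi * u) (y := Real.pi * v)
      (mul_nonneg hpi.le hu.1) (by nlinarith [hv.2]) (by nlinarith)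
    linarith
  have ha01 := hIcc ⟨le_rfl, hab.le⟩
  have hb01 := hIcc ⟨hab.le, le_rfl⟩
  obtain ⟨w, hw⟩ := mth_no_return (mthF c) (mthF_differentiable c) (mthF_real c) lam a b hab.le
    (hcont.mono hIcc) (fun t ht => by rw [hFe t (hIcc ht)]; exact Complex.ofReal_im _)
    (fun t ht him => by
      rcases le_total t t₁ with h | h
      · exact absurd (hamax ⟨⟨haI.1.trans ht.1.le, h⟩, him⟩) (not_le.2 ht.1)
      · exact absurd (hbmin ⟨⟨h, ht.2.le.trans hbI.2⟩, him⟩) (not_le.2 ht.2))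
    ha hb (fun h => hcosinj a ha01 b hb01 hab (by rw [h]))
  exact hcosinj a ha01 b hb01 hab (by rw [hw, hw])
end

section
/- Let c > 0, n₃ = ⌊(2c+1)/2⌋ + 1, t ∈ (0,1), and let b be a real number with b ≥ (2n₃)² − 2c. Then there are at most two distinct real numbers λ in the open interval (b, b+4) that are eigenvalues of H_t(c). -/
/-- The quasi-periodic exponential `exp(-i(2k+t)x)`. -/
noncomputable def mexp (t : ℝ) (k : ℤ) (x : ℝ) : ℂ :=
  Complex.exp (-Complex.I * (2 * (k : ℂ) + (t : ℂ)) * (x : ℂ))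

lemma mexp_hasDerivAt (t : ℝ) (k : ℤ) (x : ℝ) :
    HasDerivAt (mexp t k) (-Complex.I * (2 * (k : ℂ) + (t : ℂ)) * mexp t k x) x := by
  have h : HasDerivAt (fun x : ℝ => -Complex.I * (2 * (k : ℂ) + (t : ℂ)) * (x : ℂ))
      (-Complex.I * (2 * (k : ℂ) + (t : ℂ)) * 1) x :=
    (Complex.ofRealCLM.hasDerivAt (x := x)).const_mul _
  have := h.cexp
  unfold mexp
  convert this using 1
  ring

lemma mexp_continuous (t : ℝ) (k : ℤ) : Continuous (mexp t k) := by
  unfold mexp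
  fun_prop

lemma mexp_zero (t : ℝ) (k : ℤ) : mexp t k 0 = 1 := by simp [mexp]

lemma mexp_pi (t : ℝ) (k : ℤ) :
    mexp t k Real.pi * Complex.exp (Complex.I * (Real.pi : ℂ) * (t : ℂ)) = 1 := by
  unfold mexp
  rw [← Complex.exp_add, Complex.exp_eq_one_iff]
  refine ⟨-k, ?_⟩
  push_cast
  ring

lemma mexp_norm (t : ℝ) (k : ℤ) (x : ℝ) : ‖mexp t k x‖ = 1 := by
  unfold mexp
  rw [Complex.norm_exp]
  simp

lemma mexp_cos (t : ℝ) (k : ℤ) (x : ℝ) :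
    mexp t k x * (2 * Complex.cos (2 * (x : ℂ))) = mexp t (k + 1) x + mexp t (k - 1) x := by
  unfold mexp
  rw [Complex.two_cos, mul_add, ← Complex.exp_add, ← Complex.exp_add, add_comm]
  congr 1
  · congr 1
    push_cast
    ring
  · congr 1
    push_cast
    ring

lemma mathieu_fourier {c t : ℝ} {lam : ℂ} (h : mathieuEV c t lam) :
    ∃ a : ℤ → ℂ, a ≠ 0 ∧ (∃ C : ℝ, ∀ k, ‖a k‖ ≤ C) ∧
      ∀ k : ℤ, (((2 * (k : ℝ) + t) ^ 2 : ℝ) : ℂ) * a k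
        + Complex.I * (c : ℂ) * (a (k + 1) + a (k - 1)) = lam * a k := by
  obtain ⟨y, hy, ⟨x0, hx0, hyx0⟩, hode, hb0, hb1⟩ := h
  have hpi := Real.pi_pos
  have hyc : Continuous y := hy.continuous
  have hd0 : ∀ x, HasDerivAt y (deriv y x) x := fun x =>
    (hy.differentiable (by norm_num) x).hasDerivAt
  have hy1 : ContDiff ℝ 1 (deriv y) := by
    have : ContDiff ℝ (1 + 1) y := by
      have h2 : (1 + 1 : WithTop ℕ∞) = 2 := by norm_num
      rw [h2]; exact hy
    exact (contDiff_succ_iff_deriv.1 this).2.2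
  have hd1 : ∀ x, HasDerivAt (deriv y) (deriv (deriv y) x) x := fun x =>
    (hy1.differentiable (by norm_num) x).hasDerivAt
  have hy2 : Continuous (deriv (deriv y)) := hy1.continuous_deriv (by norm_num)
  have hic : ∀ k, IntervalIntegrable (fun x => mexp t k x * y x) MeasureTheory.volume 0 Real.pi :=
    fun k => ((mexp_continuous t k).mul hyc).intervalIntegrable _ _
  refine ⟨fun k => ∫ x in (0 : ℝ)..Real.pi, mexp t k x * y x, ?_, ?_, ?_⟩
  · intro h0
    have hf : Continuous (fun x : ℝ => mexp t 0 x * y x) := (mexp_continuous t 0).mul hyc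
    have hL2 : MeasureTheory.MemLp (fun x : ℝ => mexp t 0 x * y x) 2
        (MeasureTheory.volume.restrict (Set.Ioc 0 Real.pi)) := by
      obtain ⟨M, hM⟩ := (isCompact_Icc (a := (0 : ℝ)) (b := Real.pi)).exists_bound_of_continuousOn
        hf.continuousOn
      refine MeasureTheory.MemLp.of_bound hf.aestronglyMeasurable M ?_
      refine (MeasureTheory.ae_restrict_iff' measurableSet_Ioc).2 (Filter.Eventually.of_forall ?_)
      exact fun x hx => hM x (Set.Ioc_subset_Icc_self hx)
    have hs := hasSum_sq_fourierCoeffOn hpi hL2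
    have hz : ∀ k, fourierCoeffOn hpi (fun x : ℝ => mexp t 0 x * y x) k = 0 := by
      intro k
      rw [fourierCoeffOn_eq_integral]
      have : (∫ x in (0:ℝ)..Real.pi, fourier (-k) (x : AddCircle (Real.pi - 0)) •
          (mexp t 0 x * y x)) = ∫ x in (0:ℝ)..Real.pi, mexp t k x * y x := by
        apply intervalIntegral.integral_congr
        intro x _
        simp only [smul_eq_mul]
        rw [← mul_assoc]
        congr 1
        rw [fourier_coe_apply]
        unfold mexp
        rw [← Complex.exp_add]
        congr 1
        have : (Real.pi : ℂ) ≠ 0 := by exact_mod_cast hpi.ne'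
        push_cast
        field_simp
        ring
      rw [this]
      have := congrFun h0 k
      simp only [Pi.zero_apply] at this
      rw [this]; simp
    simp only [hz] at hs
    have hs0 : HasSum (fun _ : ℤ => ‖(0 : ℂ)‖ ^ 2) 0 := by
      have : ‖(0 : ℂ)‖ ^ 2 = 0 := by simp
      rw [this]; exact hasSum_zero
    have h1 := hs.unique hs0
    simp only [sub_zero, smul_eq_mul, mul_eq_zero, inv_eq_zero, hpi.ne', false_or] at h1
    have hn : ∀ x, ‖mexp t 0 x * y x‖ ^ 2 = ‖y x‖ ^ 2 := by
      intro x; rw [norm_mul, mexp_norm, one_mul]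
    simp only [hn] at h1
    have hpos : 0 < ∫ x in (0:ℝ)..Real.pi, ‖y x‖ ^ 2 := by
      apply intervalIntegral.integral_pos hpi (by fun_prop)
      · intro x _; positivity
      · exact ⟨x0, hx0, by positivity⟩
    linarith
  · refine ⟨∫ x in (0:ℝ)..Real.pi, ‖y x‖, fun k => ?_⟩
    refine (intervalIntegral.norm_integral_le_integral_norm hpi.le).trans (le_of_eq ?_)
    apply intervalIntegral.integral_congr
    intro x _
    simp only [norm_mul, mexp_norm, one_mul]
  · intro k
    set κ : ℂ := -Complex.I * (2 * (k : ℂ) + (t : ℂ)) with hκ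
    have hFTC : ∫ x in (0:ℝ)..Real.pi, (mexp t k x * (deriv (deriv y) x - κ ^ 2 * y x)) =
        mexp t k Real.pi * (deriv y Real.pi - κ * y Real.pi)
          - mexp t k 0 * (deriv y 0 - κ * y 0) := by
      apply intervalIntegral.integral_eq_sub_of_hasDerivAt
        (f := fun x => mexp t k x * (deriv y x - κ * y x))
      · intro x _
        have := (mexp_hasDerivAt t k x).mul ((hd1 x).sub ((hd0 x).const_mul κ))
        refine this.congr_deriv ?_
        simp only [Pi.sub_apply, ← hκ]
        ring
      · exact ((mexp_continuous t k).mul (hy2.sub (continuous_const.mul hyc))).intervalIntegrable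
          _ _
    have hbd : mexp t k Real.pi * (deriv y Real.pi - κ * y Real.pi)
          - mexp t k 0 * (deriv y 0 - κ * y 0) = 0 := by
      rw [hb0, hb1, mexp_zero]
      linear_combination (deriv y 0 - κ * y 0) * mexp_pi t k
    rw [hbd] at hFTC
    have hκ2 : κ ^ 2 = -(((2 * (k : ℝ) + t) ^ 2 : ℝ) : ℂ) := by
      rw [hκ]; push_cast; ring_nf; rw [Complex.I_sq]; ring
    have hE : ∫ x in (0:ℝ)..Real.pi, (mexp t k x * (deriv (deriv y) x - κ ^ 2 * y x)) =
        ∫ x in (0:ℝ)..Real.pi, ((Complex.I * (c : ℂ)) * (mexp t (k + 1) x * y x)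
          + (Complex.I * (c : ℂ)) * (mexp t (k - 1) x * y x) + (-lam - κ ^ 2) * (mexp t k x * y x))
          := by
      apply intervalIntegral.integral_congr
      intro x hx
      rw [Set.uIcc_of_le hpi.le] at hx
      have h1 := hode x hx
      have h2 := mexp_cos t k x
      simp only
      linear_combination (-mexp t k x) * h1 + Complex.I * (c : ℂ) * y x * h2
    rw [hE, intervalIntegral.integral_add, intervalIntegral.integral_add,
      intervalIntegral.integral_const_mul, intervalIntegral.integral_const_mul,
      intervalIntegral.integral_const_mul, hκ2] at hFTC
    · linear_combination hFTC
    · exact (hic _).const_mul _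
    · exact (hic _).const_mul _
    · exact ((hic _).const_mul _).add ((hic _).const_mul _)
    · exact (hic _).const_mul _

lemma mathieu_decay {c t lam C : ℝ} (hc : 0 < c) (ht : t ∈ Set.Ioo (0 : ℝ) 1) {a : ℤ → ℂ}
    (hC : ∀ k, ‖a k‖ ≤ C)
    (h : ∀ k : ℤ, (((2 * (k : ℝ) + t) ^ 2 : ℝ) : ℂ) * a k
        + Complex.I * (c : ℂ) * (a (k + 1) + a (k - 1)) = (lam : ℂ) * a k) :
    ∃ K : ℝ, ∀ k : ℤ, (1 + (k : ℝ) ^ 2) * ‖a k‖ ≤ K := by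
  refine ⟨C * (1 + |lam| + 2 * c), fun k => ?_⟩
  have hmu : (k : ℝ) ^ 2 ≤ (2 * (k : ℝ) + t) ^ 2 := by
    obtain ⟨h0, h1⟩ := ht
    rcases lt_trichotomy k 0 with hk | hk | hk
    · have : (k : ℝ) ≤ -1 := by exact_mod_cast (by omega : k ≤ -1)
      nlinarith
    · subst hk; norm_num; positivity
    · have : (1 : ℝ) ≤ k := by exact_mod_cast hk
      nlinarith
  have h1 : (((2 * (k : ℝ) + t) ^ 2 : ℝ) : ℂ) * a k =
      (lam : ℂ) * a k - Complex.I * (c : ℂ) * (a (k + 1) + a (k - 1)) := by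
    linear_combination h k
  have h2 : (2 * (k : ℝ) + t) ^ 2 * ‖a k‖ ≤ |lam| * ‖a k‖ + c * (‖a (k+1)‖ + ‖a (k-1)‖) := by
    have h3 := congrArg norm h1
    rw [norm_mul, Complex.norm_real, Real.norm_of_nonneg (by positivity)] at h3
    rw [h3]
    refine (norm_sub_le _ _).trans ?_
    rw [norm_mul, norm_mul, norm_mul, Complex.norm_real, Complex.norm_I, Complex.norm_real,
      Real.norm_of_nonneg hc.le, one_mul, Real.norm_eq_abs]
    gcongr
    exact norm_add_le _ _
  have h4 : (k : ℝ) ^ 2 * ‖a k‖ ≤ (2 * (k : ℝ) + t) ^ 2 * ‖a k‖ := by gcongr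
  have h5 : |lam| * ‖a k‖ ≤ |lam| * C := by gcongr; exact hC k
  have h6 : c * (‖a (k+1)‖ + ‖a (k-1)‖) ≤ c * (C + C) := by
    gcongr
    · exact hC _
    · exact hC _
  nlinarith [hC k]

lemma summable_int_inv_sq : Summable (fun k : ℤ => (1 + (k : ℝ) ^ 2)⁻¹) := by
  have h : Summable (fun k : ℤ => 1 / (k : ℝ) ^ 2) := Real.summable_one_div_int_pow.2 (by norm_num)
  have h0 : Summable (fun k : ℤ => if k = 0 then (1 : ℝ) else 0) :=
    summable_of_hasFiniteSupport ((Set.finite_singleton (0 : ℤ)).subset (by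
      intro k hk
      by_contra hne
      simp only [Set.mem_singleton_iff] at hne
      simp [hne] at hk))
  refine Summable.of_nonneg_of_le (fun k => by positivity) (fun k => ?_) (h.add h0)
  by_cases hk : k = 0
  · subst hk; norm_num
  · have : (0 : ℝ) < (k : ℝ) ^ 2 := by
      have : (k : ℝ) ≠ 0 := by exact_mod_cast hk
      positivity
    simp only [hk, if_false, add_zero, one_div]
    gcongr
    linarith

/-- Weighted square summability from the decay. -/
lemma decay_summable {u : ℤ → ℂ} {K : ℝ} (hK : ∀ k : ℤ, (1 + (k : ℝ) ^ 2) * ‖u k‖ ≤ K)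
    {w : ℤ → ℝ} {A : ℝ} (hA : 0 ≤ A) (hw0 : ∀ k, 0 ≤ w k)
    (hw : ∀ k : ℤ, w k ≤ A * (1 + (k : ℝ) ^ 2)) :
    Summable (fun k => w k * ‖u k‖ ^ 2) := by
  refine Summable.of_nonneg_of_le (fun k => mul_nonneg (hw0 k) (by positivity)) (fun k => ?_)
    (summable_int_inv_sq.mul_left (A * K ^ 2))
  have hp : 0 < 1 + (k : ℝ) ^ 2 := by positivity
  rw [← div_eq_mul_inv, le_div_iff₀ hp]
  have h1 : w k * ‖u k‖ ^ 2 * (1 + (k : ℝ) ^ 2) ≤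
      A * (1 + (k : ℝ) ^ 2) * ‖u k‖ ^ 2 * (1 + (k : ℝ) ^ 2) := by
    gcongr
    exact hw k
  have h2 : ((1 + (k : ℝ) ^ 2) * ‖u k‖) ^ 2 ≤ K ^ 2 := by
    gcongr
    exact hK k
  nlinarith [mul_le_mul_of_nonneg_left h2 hA]

set_option maxHeartbeats 1000000 in
/-- Positivity of the indefinite form. -/
lemma pos_form (c τ : ℝ) (hc : 0 < c) (μ ε r l : ℤ → ℝ)
    (hε : ∀ k, ε k = 1 ∨ ε k = -1) (hr : ∀ k, 0 ≤ r k) (hl : ∀ k, 0 ≤ l k)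
    (hw : ∀ k, r k + l k = ε k * (μ k - τ)) (hw0 : ∀ k, 0 < r k + l k)
    (hlink : ∀ k, ε k ≠ ε (k + 1) → c ^ 2 < r k * l (k + 1))
    (u : ℤ → ℂ) (hu : u ≠ 0)
    (hs : Summable (fun k => (r k + l k) * ‖u k‖ ^ 2))
    (hs0 : Summable (fun k => ‖u k‖ ^ 2)) :
    0 < ∑' k, ε k * ((starRingEnd ℂ) (u k) *
      (((μ k - τ : ℝ) : ℂ) * u k + Complex.I * (c : ℂ) * (u (k + 1) + u (k - 1)))).re := by
  set X : ℤ → ℝ := fun k => (Complex.I * (starRingEnd ℂ) (u k) * u (k + 1)).re with hX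
  have hXb : ∀ k, |X k| ≤ ‖u k‖ * ‖u (k + 1)‖ := by
    intro k
    refine (Complex.abs_re_le_norm _).trans (le_of_eq ?_)
    rw [norm_mul, norm_mul, Complex.norm_I, one_mul, RCLike.norm_conj]
  have hs1 : Summable (fun k => ‖u (k + 1)‖ ^ 2) :=
    (Equiv.addRight (1 : ℤ)).summable_iff.2 hs0
  have hXs : Summable (fun k => |X k|) := by
    refine Summable.of_nonneg_of_le (fun k => abs_nonneg _) (fun k => ?_) (hs0.add hs1)
    have := hXb k
    nlinarith [sq_nonneg (‖u k‖ - ‖u (k + 1)‖), sq_nonneg (‖u k‖), sq_nonneg (‖u (k+1)‖)]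
  have hεa : ∀ k, |ε k| = 1 := by
    intro k; rcases hε k with h | h <;> simp [h]
  have hεX : Summable (fun k => c * ε k * X k) := by
    refine Summable.of_norm ?_
    have : (fun k => ‖c * ε k * X k‖) = fun k => c * |X k| := by
      funext k
      rw [Real.norm_eq_abs, abs_mul, abs_mul, hεa, abs_of_pos hc, mul_one]
    rw [this]; exact hXs.mul_left c
  have hεX1 : Summable (fun k => c * ε (k + 1) * X k) := by
    refine Summable.of_norm ?_
    have : (fun k => ‖c * ε (k + 1) * X k‖) = fun k => c * |X k| := by
      funext k
      rw [Real.norm_eq_abs, abs_mul, abs_mul, hεa, abs_of_pos hc, mul_one]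
    rw [this]; exact hXs.mul_left c
  have hrs : Summable (fun k => r k * ‖u k‖ ^ 2) := by
    refine Summable.of_nonneg_of_le (fun k => mul_nonneg (hr k) (by positivity)) (fun k => ?_) hs
    gcongr
    linarith [hl k]
  have hls : Summable (fun k => l k * ‖u k‖ ^ 2) := by
    refine Summable.of_nonneg_of_le (fun k => mul_nonneg (hl k) (by positivity)) (fun k => ?_) hs
    gcongr
    linarith [hr k]
  have hls1 : Summable (fun k => l (k + 1) * ‖u (k + 1)‖ ^ 2) :=
    (Equiv.addRight (1 : ℤ)).summable_iff.2 hls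
  set F : ℤ → ℝ := fun k => l k * ‖u k‖ ^ 2 - c * ε k * X (k - 1) with hF
  have hF1 : (fun k => F (k + 1)) =
      fun k => l (k + 1) * ‖u (k + 1)‖ ^ 2 - c * ε (k + 1) * X k := by
    funext k; simp [hF]
  have hF1s : Summable (fun k => F (k + 1)) := by
    rw [hF1]; exact hls1.sub hεX1
  have hFs : Summable F := (Equiv.addRight (1 : ℤ)).summable_iff.1 hF1s
  have hFt : ∑' k, F (k + 1) = ∑' k, F k := (Equiv.addRight (1 : ℤ)).tsum_eq F
  have hterm : ∀ k, ε k * ((starRingEnd ℂ) (u k) *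
      (((μ k - τ : ℝ) : ℂ) * u k + Complex.I * (c : ℂ) * (u (k + 1) + u (k - 1)))).re
      = (r k * ‖u k‖ ^ 2 + c * ε k * X k) + F k := by
    intro k
    have h1 : ((starRingEnd ℂ) (u k) * (((μ k - τ : ℝ) : ℂ) * u k
        + Complex.I * (c : ℂ) * (u (k + 1) + u (k - 1)))).re =
        (μ k - τ) * ‖u k‖ ^ 2 + c * X k - c * X (k - 1) := by
      rw [← Complex.normSq_eq_norm_sq]
      simp [hX, Complex.normSq_apply]
      ring
    rw [h1]
    simp only [hF]
    linear_combination (-‖u k‖ ^ 2) * hw k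
  rw [tsum_congr hterm, (hrs.add hεX).tsum_add hFs, ← hFt, ← (hrs.add hεX).tsum_add hF1s]
  simp only [fun k => congrFun hF1 k]
  have hSs := (hrs.add hεX).add hF1s
  simp only [fun k => congrFun hF1 k] at hSs
  have hcase : ∀ k, 0 ≤ r k * ‖u k‖ ^ 2 + c * ε k * X k +
      (l (k + 1) * ‖u (k + 1)‖ ^ 2 - c * ε (k + 1) * X k) ∧
      (r k * ‖u k‖ ^ 2 + c * ε k * X k +
      (l (k + 1) * ‖u (k + 1)‖ ^ 2 - c * ε (k + 1) * X k) = 0 →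
        r k * ‖u k‖ ^ 2 = 0 ∧ l (k + 1) * ‖u (k + 1)‖ ^ 2 = 0) := by
    intro k
    have hr1 : 0 ≤ r k * ‖u k‖ ^ 2 := mul_nonneg (hr k) (by positivity)
    have hl1 : 0 ≤ l (k + 1) * ‖u (k + 1)‖ ^ 2 := mul_nonneg (hl _) (by positivity)
    by_cases he : ε k = ε (k + 1)
    · rw [he]
      refine ⟨by nlinarith, fun h => ⟨by nlinarith, by nlinarith⟩⟩
    · have hlk := hlink k he
      have hX2 : |c * ε k * X k - c * ε (k + 1) * X k| ≤ 2 * c * (‖u k‖ * ‖u (k + 1)‖) := by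
        have : |c * ε k * X k - c * ε (k + 1) * X k| = |ε k - ε (k + 1)| * c * |X k| := by
          rw [← abs_of_pos hc, ← abs_mul, ← abs_mul, abs_of_pos hc]
          congr 1; ring
        rw [this]
        have h2 : |ε k - ε (k + 1)| ≤ 2 := by
          rcases hε k with h | h <;> rcases hε (k + 1) with h' | h' <;> rw [h, h'] <;> norm_num
        calc |ε k - ε (k + 1)| * c * |X k| ≤ 2 * c * (‖u k‖ * ‖u (k + 1)‖) := by
              gcongr
              exact hXb k
          _ = _ := rfl
      have hX3 := abs_le.1 hX2
      set p := ‖u k‖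
      set q := ‖u (k + 1)‖
      have hp0 : 0 ≤ p := norm_nonneg _
      have hq0 : 0 ≤ q := norm_nonneg _
      have hrpos : 0 < r k := by
        rcases (hr k).lt_or_eq with h | h
        · exact h
        · rw [← h] at hlk; nlinarith
      have hkey : r k * (r k * p ^ 2 + l (k + 1) * q ^ 2 - 2 * c * (p * q)) =
          (r k * p - c * q) ^ 2 + (r k * l (k + 1) - c ^ 2) * q ^ 2 := by ring
      have hge : r k * p ^ 2 + l (k + 1) * q ^ 2 - 2 * c * (p * q) ≤
        r k * p ^ 2 + c * ε k * X k + (l (k + 1) * q ^ 2 - c * ε (k + 1) * X k) := by linarith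
      have hq2 : 0 ≤ (r k * l (k + 1) - c ^ 2) * q ^ 2 :=
        mul_nonneg (by linarith) (by positivity)
      have hbase : 0 ≤ r k * p ^ 2 + l (k + 1) * q ^ 2 - 2 * c * (p * q) := by
        by_contra hneg
        push Not at hneg
        nlinarith [sq_nonneg (r k * p - c * q)]
      refine ⟨hbase.trans hge, fun h => ?_⟩
      have hz : r k * p ^ 2 + l (k + 1) * q ^ 2 - 2 * c * (p * q) = 0 := by linarith
      rw [hz, mul_zero] at hkey
      have hA : (r k * l (k + 1) - c ^ 2) * q ^ 2 = 0 := by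
        nlinarith [sq_nonneg (r k * p - c * q)]
      have hB : (r k * p - c * q) ^ 2 = 0 := by linarith
      have hq : q = 0 := by
        rcases mul_eq_zero.1 hA with h | h
        · linarith
        · exact pow_eq_zero_iff (by norm_num) |>.1 h
      have hp : p = 0 := by
        have h' := pow_eq_zero_iff (by norm_num) |>.1 hB
        rw [hq, mul_zero, sub_zero] at h'
        rcases mul_eq_zero.1 h' with h | h
        · linarith
        · exact h
      rw [hp, hq]; norm_num
  obtain ⟨j, hj⟩ : ∃ j, u j ≠ 0 := by
    by_contra hne
    push Not at hne
    exact hu (funext hne)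
  have hjn : 0 < ‖u j‖ ^ 2 := by positivity
  have hposr : 0 < r j ∨ 0 < l j := by
    by_contra hne
    push Not at hne
    linarith [hw0 j, hne.1, hne.2]
  rcases hposr with h | h
  · refine hSs.tsum_pos (fun k => (hcase k).1) j ?_
    rcases (hcase j).1.lt_or_eq with h1 | h1
    · exact h1
    · have := ((hcase j).2 h1.symm).1
      have := mul_pos h hjn
      linarith
  · refine hSs.tsum_pos (fun k => (hcase k).1) (j - 1) ?_
    rcases (hcase (j - 1)).1.lt_or_eq with h1 | h1
    · exact h1
    · have h2 := ((hcase (j - 1)).2 h1.symm).2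
      rw [sub_add_cancel] at h2
      have := mul_pos h hjn
      linarith

/-- A Lyapunov argument along the linear flow. -/
lemma lyap (a : Fin 3 → ℤ → ℂ) (ε : ℤ → ℝ) (hε : ∀ k, ε k = 1 ∨ ε k = -1)
    (ha : ∀ i, Summable (fun k => ‖a i k‖ ^ 2)) (ν : Fin 3 → ℝ)
    (hpos : ∀ x : Fin 3 → ℝ, (∀ i, 0 < x i) →
      0 < ∑' k, ε k * ((starRingEnd ℂ) (∑ i, (x i : ℂ) * a i k) *
        (∑ i, ((ν i * x i : ℝ) : ℂ) * a i k)).re) :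
    ((∀ i, ν i < 0) → ∑' k, ε k * ‖∑ i, a i k‖ ^ 2 < 0) ∧
    ((∀ i, 0 < ν i) → 0 < ∑' k, ε k * ‖∑ i, a i k‖ ^ 2) := by
  have hεa : ∀ k, |ε k| = 1 := by
    intro k; rcases hε k with h | h <;> simp [h]
  have hms : ∀ i j, Summable (fun k => ε k * ((starRingEnd ℂ) (a i k) * a j k).re) := by
    intro i j
    refine Summable.of_norm_bounded ((ha i).add (ha j)) (fun k => ?_)
    rw [Real.norm_eq_abs, abs_mul, hεa, one_mul]
    refine (Complex.abs_re_le_norm _).trans ?_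
    rw [norm_mul, RCLike.norm_conj]
    nlinarith [sq_nonneg (‖a i k‖ - ‖a j k‖), sq_nonneg (‖a i k‖), sq_nonneg (‖a j k‖)]
  set M : Fin 3 → Fin 3 → ℝ := fun i j => ∑' k, ε k * ((starRingEnd ℂ) (a i k) * a j k).re with hM
  have hMsymm : ∀ i j, M i j = M j i := by
    intro i j
    simp only [hM]
    refine tsum_congr fun k => ?_
    congr 1
    simp
    ring
  have hQ : ∀ x y : Fin 3 → ℝ, ∑' k, ε k * ((starRingEnd ℂ) (∑ i, (x i : ℂ) * a i k) *
        (∑ i, ((y i : ℝ) : ℂ) * a i k)).re = ∑ i, ∑ j, x i * y j * M i j := by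
    intro x y
    have h1 : ∀ k, ε k * ((starRingEnd ℂ) (∑ i, (x i : ℂ) * a i k) *
        (∑ i, ((y i : ℝ) : ℂ) * a i k)).re =
        ∑ i, ∑ j, x i * y j * (ε k * ((starRingEnd ℂ) (a i k) * a j k).re) := by
      intro k
      simp only [Fin.sum_univ_three]
      simp
      ring
    rw [tsum_congr h1]
    rw [Summable.tsum_finsetSum (fun i _ => summable_sum (fun j _ => (hms i j).mul_left _))]
    refine Finset.sum_congr rfl fun i _ => ?_
    rw [Summable.tsum_finsetSum (fun j _ => (hms i j).mul_left _)]
    refine Finset.sum_congr rfl fun j _ => ?_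
    rw [tsum_mul_left]
  set f : ℝ → ℝ := fun s => ∑ i, ∑ j, Real.exp ((ν i + ν j) * s) * M i j with hf
  have hd : ∀ s, HasDerivAt f (∑ i, ∑ j, (ν i + ν j) * Real.exp ((ν i + ν j) * s) * M i j) s := by
    intro s
    refine HasDerivAt.fun_sum fun i _ => HasDerivAt.fun_sum fun j _ => ?_
    have h1 : HasDerivAt (fun s : ℝ => (ν i + ν j) * s) ((ν i + ν j) * 1) s :=
      (hasDerivAt_id s).const_mul _
    have h2 := (h1.exp).mul_const (M i j)
    refine h2.congr_deriv ?_
    ring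
  have hdpos : ∀ s, 0 < ∑ i, ∑ j, (ν i + ν j) * Real.exp ((ν i + ν j) * s) * M i j := by
    intro s
    have h1 := hpos (fun i => Real.exp (ν i * s)) (fun i => Real.exp_pos _)
    rw [hQ] at h1
    have h2 : ∑ i, ∑ j, (ν i + ν j) * Real.exp ((ν i + ν j) * s) * M i j =
        2 * ∑ i, ∑ j, Real.exp (ν i * s) * (ν j * Real.exp (ν j * s)) * M i j := by
      have h3 : ∀ i j, Real.exp ((ν i + ν j) * s) = Real.exp (ν i * s) * Real.exp (ν j * s) := by
        intro i j; rw [← Real.exp_add]; congr 1; ring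
      simp only [h3, Fin.sum_univ_three]
      rw [hMsymm 1 0, hMsymm 2 0, hMsymm 2 1]
      ring
    rw [h2]; linarith
  have hmono : StrictMono f := strictMono_of_deriv_pos (fun s => by rw [(hd s).deriv]; exact hdpos s)
  have hf0 : f 0 = ∑' k, ε k * ‖∑ i, a i k‖ ^ 2 := by
    have h1 := hQ (fun _ => 1) (fun _ => 1)
    simp only [hf, mul_zero, Real.exp_zero]
    simp only [one_mul, Complex.ofReal_one, mul_one] at h1
    simp only [one_mul]
    rw [← h1]
    refine tsum_congr fun k => ?_
    congr 1
    rw [← Complex.normSq_eq_norm_sq, Complex.normSq_apply]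
    simp
  rw [← hf0]
  constructor
  · intro hν
    have hlim : Filter.Tendsto f Filter.atTop (nhds 0) := by
      have : (0 : ℝ) = ∑ i : Fin 3, ∑ j : Fin 3, 0 * M i j := by simp
      rw [this]
      refine tendsto_finsetSum _ fun i _ => tendsto_finsetSum _ fun j _ => ?_
      refine Filter.Tendsto.mul_const _ ?_
      refine Real.tendsto_exp_atBot.comp ?_
      exact Filter.tendsto_id.const_mul_atTop_of_neg (by linarith [hν i, hν j])
    have h1 : f 1 ≤ 0 := hmono.monotone.ge_of_tendsto hlim 1
    exact (hmono (by norm_num : (0 : ℝ) < 1)).trans_le h1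
  · intro hν
    have hlim : Filter.Tendsto f Filter.atBot (nhds 0) := by
      have : (0 : ℝ) = ∑ i : Fin 3, ∑ j : Fin 3, 0 * M i j := by simp
      rw [this]
      refine tendsto_finsetSum _ fun i _ => tendsto_finsetSum _ fun j _ => ?_
      refine Filter.Tendsto.mul_const _ ?_
      refine Real.tendsto_exp_atBot.comp ?_
      exact Filter.tendsto_id.const_mul_atBot (by linarith [hν i, hν j])
    have h1 : 0 ≤ f (-1) := hmono.monotone.le_of_tendsto hlim (-1)
    exact h1.trans_lt (hmono (by norm_num : (-1 : ℝ) < 0))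

/-- Unperturbed eigenvalues. -/
noncomputable def mmu (t : ℝ) (k : ℤ) : ℝ := (2 * (k : ℝ) + t) ^ 2

lemma chain_aux {x x' S lo hi : ℝ} (hx : 0 < x) (hxx : x + 2 ≤ x') (hS : 0 ≤ S)
    (hlo : S ^ 2 ≤ lo) (h1 : lo < x ^ 2) (h2 : x' ^ 2 < hi) (hl : hi - lo ≤ 4 * S + 4) : False := by
  have h3 : S < x := by
    by_contra h
    push Not at h
    nlinarith
  nlinarith

/-- On each of the two chains a short window contains at most one unperturbed eigenvalue. -/
lemma chain_unique {t S lo hi : ℝ} (ht : t ∈ Set.Ioo (0 : ℝ) 1) (hS : 0 ≤ S) (hlo : S ^ 2 ≤ lo)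
    (hl : hi - lo ≤ 4 * S + 4) {k k' : ℤ} (hk : mmu t k ∈ Set.Ioo lo hi)
    (hk' : mmu t k' ∈ Set.Ioo lo hi) (hs : 0 ≤ k ↔ 0 ≤ k') : k = k' := by
  by_contra hne
  wlog hlt : k < k' generalizing k k'
  · exact this hk' hk hs.symm (Ne.symm hne) (by omega)
  obtain ⟨h0, h1⟩ := ht
  have hlt' : (k : ℝ) + 1 ≤ k' := by exact_mod_cast hlt
  unfold mmu at hk hk'
  by_cases h : 0 ≤ k
  · have hk0 : (0 : ℝ) ≤ k := by exact_mod_cast h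
    exact chain_aux (x := 2 * (k : ℝ) + t) (x' := 2 * (k' : ℝ) + t) (by linarith) (by linarith)
      hS hlo hk.1 hk'.2 hl
  · have hk0 : (k' : ℝ) ≤ -1 := by exact_mod_cast (by omega : k' ≤ -1)
    exact chain_aux (x := -(2 * (k' : ℝ) + t)) (x' := -(2 * (k : ℝ) + t)) (by linarith)
      (by linarith) hS hlo (by rw [neg_sq]; exact hk'.1) (by rw [neg_sq]; exact hk.2) hl

lemma cut_exists {t c b0 S : ℝ} (hc : 0 < c) (ht : t ∈ Set.Ioo (0 : ℝ) 1) (hS : 0 ≤ S)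
    (hlo : S ^ 2 ≤ b0 - c / 2) (hl : 3 * c ≤ 4 * S + 4) :
    ∃ σ, b0 ≤ σ ∧ σ ≤ b0 + 2 * c ∧ ∀ k, c / 2 ≤ |mmu t k - σ| := by
  by_contra hcon
  push Not at hcon
  obtain ⟨k1, h1⟩ := hcon b0 le_rfl (by linarith)
  obtain ⟨k2, h2⟩ := hcon (b0 + c) (by linarith) (by linarith)
  obtain ⟨k3, h3⟩ := hcon (b0 + 2 * c) (by linarith) (by linarith)
  rw [abs_lt] at h1 h2 h3
  have m1 : mmu t k1 ∈ Set.Ioo (b0 - c / 2) (b0 + 5 * c / 2) :=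
    ⟨by linarith [h1.1], by linarith [h1.2]⟩
  have m2 : mmu t k2 ∈ Set.Ioo (b0 - c / 2) (b0 + 5 * c / 2) :=
    ⟨by linarith [h2.1], by linarith [h2.2]⟩
  have m3 : mmu t k3 ∈ Set.Ioo (b0 - c / 2) (b0 + 5 * c / 2) :=
    ⟨by linarith [h3.1], by linarith [h3.2]⟩
  have hl' : (b0 + 5 * c / 2) - (b0 - c / 2) ≤ 4 * S + 4 := by linarith
  have n12 : k1 ≠ k2 := by rintro rfl; linarith [h1.2, h2.1]
  have n13 : k1 ≠ k3 := by rintro rfl; linarith [h1.2, h3.1]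
  have n23 : k2 ≠ k3 := by rintro rfl; linarith [h2.2, h3.1]
  have q12 : ¬ (0 ≤ k1 ↔ 0 ≤ k2) := fun h => n12 (chain_unique ht hS hlo hl' m1 m2 h)
  have q13 : ¬ (0 ≤ k1 ↔ 0 ≤ k3) := fun h => n13 (chain_unique ht hS hlo hl' m1 m3 h)
  have q23 : ¬ (0 ≤ k2 ↔ 0 ≤ k3) := fun h => n23 (chain_unique ht hS hlo hl' m2 m3 h)
  tauto

lemma link_prod {x σ c : ℝ} (hc : 0 < c) (hx : 0 < x) (hσ : (1 + 5 / 8 * c) ^ 2 ≤ σ)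
    (h1 : c / 2 ≤ σ - x ^ 2) (h2 : c / 2 ≤ (x + 2) ^ 2 - σ) :
    c ^ 2 < (σ - x ^ 2) * ((x + 2) ^ 2 - σ) := by
  have hu : 1 + 5 / 8 * c < x + 2 := by
    by_contra h
    push Not at h
    nlinarith
  nlinarith [mul_nonneg (sub_nonneg.2 h1) (sub_nonneg.2 h2)]

lemma split_exists {t σ c : ℝ} (hc : 0 < c) (hc2 : c < 1 / 2) (ht : t ∈ Set.Ioo (0 : ℝ) 1)
    (hσ : 4 - 4 * c ≤ σ) (hd : c / 2 ≤ (2 - t) ^ 2 - σ) :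
    ∃ ρ : ℝ, 0 ≤ ρ ∧ ρ ≤ 1 ∧ c ^ 2 < ρ * (σ - t ^ 2) * ((2 + t) ^ 2 - σ) ∧
      c ^ 2 < (1 - ρ) * (σ - t ^ 2) * ((2 - t) ^ 2 - σ) := by
  obtain ⟨h0, h1⟩ := ht
  have hw1 : (2 + t) ^ 2 - σ = (2 - t) ^ 2 - σ + 8 * t := by ring
  set w := (2 - t) ^ 2 - σ with hw
  rw [hw1]
  by_cases ht8 : t ≤ 1 / 8
  · have ht2 : t ^ 2 ≤ 1 / 64 := by nlinarith
    refine ⟨1 / 2, by norm_num, by norm_num, ?_, ?_⟩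
    all_goals
      by_cases h3 : 3 ≤ σ
      · have : 2 < σ - t ^ 2 := by linarith
        nlinarith
      · push Not at h3
        have hw2 : c ≤ w := by nlinarith
        have : 1.5 < σ - t ^ 2 := by linarith
        nlinarith
  · push Not at ht8
    have ht3 : t < 0.586 := by
      by_contra h
      push Not at h
      nlinarith
    have hw0 : 1.65 < σ - t ^ 2 := by nlinarith
    refine ⟨1 / 5, by norm_num, by norm_num, ?_, ?_⟩
    · have : 2.5 * c ≤ w + 8 * t := by linarith
      have h5 : 3.3 * c * (2.5 * c) ≤ (σ - t ^ 2) * (w + 8 * t) := by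
        apply mul_le_mul <;> nlinarith
      nlinarith
    · have h5 : 3.3 * c * (c / 2) ≤ (σ - t ^ 2) * w := by
        apply mul_le_mul <;> nlinarith
      nlinarith

/-- Signs attached to a cut. -/
noncomputable def msgn (t σ : ℝ) (k : ℤ) : ℝ := if mmu t k < σ then -1 else 1

lemma alloc_exists {t σ c : ℝ} (hc : 0 < c) (ht : t ∈ Set.Ioo (0 : ℝ) 1)
    (hσ : (1 + 5 / 8 * c) ^ 2 ≤ σ) (hd : ∀ k, c / 2 ≤ |mmu t k - σ|)
    (hsplit : σ < (2 - t) ^ 2 → ∃ ρ : ℝ, 0 ≤ ρ ∧ ρ ≤ 1 ∧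
      c ^ 2 < ρ * (σ - t ^ 2) * ((2 + t) ^ 2 - σ) ∧
      c ^ 2 < (1 - ρ) * (σ - t ^ 2) * ((2 - t) ^ 2 - σ)) :
    ∃ r l : ℤ → ℝ, (∀ k, 0 ≤ r k) ∧ (∀ k, 0 ≤ l k) ∧
      (∀ k, r k + l k = msgn t σ k * (mmu t k - σ)) ∧ (∀ k, 0 < r k + l k) ∧
      (∀ k, msgn t σ k ≠ msgn t σ (k + 1) → c ^ 2 < r k * l (k + 1)) := by
  obtain ⟨ρ, hρ0, hρ1, hρ⟩ : ∃ ρ : ℝ, 0 ≤ ρ ∧ ρ ≤ 1 ∧ ((σ < (2 - t) ^ 2 →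
      c ^ 2 < ρ * (σ - t ^ 2) * ((2 + t) ^ 2 - σ) ∧
      c ^ 2 < (1 - ρ) * (σ - t ^ 2) * ((2 - t) ^ 2 - σ)) ∧ (¬ σ < (2 - t) ^ 2 → ρ = 1)) := by
    by_cases h : σ < (2 - t) ^ 2
    · obtain ⟨ρ, a, b, d⟩ := hsplit h
      exact ⟨ρ, a, b, fun _ => d, fun h' => absurd h h'⟩
    · exact ⟨1, by norm_num, le_rfl, fun h' => absurd h' h, fun _ => rfl⟩
  obtain ⟨h0, h1⟩ := ht
  have hw : ∀ k, msgn t σ k * (mmu t k - σ) = |mmu t k - σ| := by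
    intro k
    unfold msgn
    split_ifs with h
    · rw [abs_of_neg (by linarith)]; ring
    · rw [abs_of_nonneg (by linarith)]; ring
  have hin : ∀ k, mmu t k < σ → c / 2 ≤ σ - mmu t k := by
    intro k h
    have := hd k
    rw [abs_of_neg (by linarith)] at this
    linarith
  have hout : ∀ k, ¬ mmu t k < σ → c / 2 ≤ mmu t k - σ := by
    intro k h
    have := hd k
    rw [abs_of_nonneg (by linarith)] at this
    linarith
  -- the share of the right link
  set p : ℤ → ℝ := fun k => if k = 0 then ρ else
    if 0 < k then (if mmu t k < σ then 1 else 0) else (if mmu t k < σ then 0 else 1) with hp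
  have hp0 : ∀ k, 0 ≤ p k := by
    intro k; simp only [hp]; split_ifs <;> first | exact hρ0 | norm_num
  have hp1 : ∀ k, p k ≤ 1 := by
    intro k; simp only [hp]; split_ifs <;> first | exact hρ1 | norm_num
  refine ⟨fun k => p k * |mmu t k - σ|, fun k => (1 - p k) * |mmu t k - σ|,
    fun k => mul_nonneg (hp0 k) (abs_nonneg _),
    fun k => mul_nonneg (by linarith [hp1 k]) (abs_nonneg _), fun k => ?_, fun k => ?_, ?_⟩
  · rw [hw]; ring
  · have := hd k
    simp only
    linarith
  · intro k hk
    show c ^ 2 < (p k * |mmu t k - σ|) * ((1 - p (k + 1)) * |mmu t (k + 1) - σ|)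
    have hσ1 : 1 < σ := by nlinarith
    have hz : mmu t 0 < σ := by
      unfold mmu; norm_num; nlinarith
    have hm0 : mmu t 0 = t ^ 2 := by unfold mmu; norm_num
    have hm1 : mmu t 1 = (2 + t) ^ 2 := by unfold mmu; norm_num
    have hmm : mmu t (-1) = (2 - t) ^ 2 := by unfold mmu; push_cast; ring
    rcases lt_trichotomy k 0 with hk0 | hk0 | hk0
    · by_cases hk1 : k = -1
      · subst hk1
        have hno : ¬ mmu t (-1) < σ := by
          intro h
          apply hk
          simp [msgn, h, hz]
        have hgt : σ < (2 - t) ^ 2 := by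
          have := hout _ hno
          rw [hmm] at this; linarith
        have hh := (hρ.1 hgt).2
        have e1 : p (-1) = 1 := by simp [hp, hno]
        have e2 : p 0 = ρ := by simp [hp]
        rw [show (-1 : ℤ) + 1 = 0 by norm_num, e1, e2, abs_of_neg (by linarith : mmu t 0 - σ < 0),
          hm0, hmm, abs_of_pos (by linarith)]
        linarith
      · have hk2 : (k : ℝ) ≤ -2 := by exact_mod_cast (by omega : k ≤ -2)
        have hmono : mmu t (k + 1) < mmu t k := by
          unfold mmu; push_cast; nlinarith
        have hnk : ¬ mmu t k < σ := by
          intro h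
          exact hk (by simp [msgn, h, hmono.trans h])
        have hk1' : mmu t (k + 1) < σ := by
          by_contra h
          exact hk (by simp [msgn, h, hnk])
        have e1 : p k = 1 := by simp [hp, hnk, hk0.ne, hk0.not_gt]
        have e2 : p (k + 1) = 0 := by
          simp only [hp]
          rw [if_neg (by omega), if_neg (by omega), if_pos hk1']
        have a1 := hout _ hnk
        have a2 := hin _ hk1'
        rw [e1, e2, abs_of_neg (by linarith : mmu t (k + 1) - σ < 0), abs_of_pos (by linarith)]
        have := link_prod (x := -(2 * ((k + 1 : ℤ) : ℝ) + t)) hc (by push_cast; linarith) hσ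
          (by rw [neg_sq]; exact a2)
          (by
            have : (-(2 * ((k + 1 : ℤ) : ℝ) + t) + 2) ^ 2 = mmu t k := by
              unfold mmu; push_cast; ring
            rw [this]; exact a1)
        have e3 : (-(2 * ((k + 1 : ℤ) : ℝ) + t) + 2) ^ 2 = mmu t k := by
              unfold mmu; push_cast; ring
        have e4 : (-(2 * ((k + 1 : ℤ) : ℝ) + t)) ^ 2 = mmu t (k + 1) := by
              unfold mmu; ring
        rw [e3, e4] at this
        linarith
    · subst hk0
      have hno : ¬ mmu t 1 < σ := by
        intro h
        apply hk
        simp [msgn, h, hz]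
      have a1 := hout _ hno
      have a2 := hin _ hz
      have e1 : p 1 = 0 := by simp [hp, hno]
      have e2 : p 0 = ρ := by simp [hp]
      rw [show (0 : ℤ) + 1 = 1 by norm_num, e1, e2, abs_of_neg (by linarith : mmu t 0 - σ < 0),
          abs_of_pos (by linarith)]
      rw [hm0] at a2
      rw [hm1] at a1
      rw [hm0, hm1]
      by_cases hgt : σ < (2 - t) ^ 2
      · have := (hρ.1 hgt).1
        linarith
      · rw [hρ.2 hgt]
        have := link_prod (x := t) hc h0 hσ a2 (by rw [add_comm t 2]; exact a1)
        rw [add_comm t 2] at this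
        linarith
    · have hk1 : (1 : ℝ) ≤ k := by exact_mod_cast hk0
      have hmono : mmu t k < mmu t (k + 1) := by
        unfold mmu; push_cast; nlinarith
      have hnk : ¬ mmu t (k + 1) < σ := by
        intro h
        exact hk (by simp [msgn, h, hmono.trans h])
      have hk1' : mmu t k < σ := by
        by_contra h
        exact hk (by simp [msgn, h, hnk])
      have e1 : p k = 1 := by simp [hp, hk1', hk0.ne', hk0]
      have e2 : p (k + 1) = 0 := by
        simp only [hp]
        rw [if_neg (by omega), if_pos (by omega), if_neg hnk]
      have a1 := hout _ hnk
      have a2 := hin _ hk1'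
      rw [e1, e2, abs_of_neg (by linarith : mmu t k - σ < 0), abs_of_pos (by linarith)]
      have e3 : (2 * (k : ℝ) + t + 2) ^ 2 = mmu t (k + 1) := by
        unfold mmu; push_cast; ring
      have := link_prod (x := 2 * (k : ℝ) + t) hc (by linarith) hσ a2 (by rw [e3]; exact a1)
      rw [e3] at this
      have e4 : (2 * (k : ℝ) + t) ^ 2 = mmu t k := rfl
      rw [e4] at this
      linarith

/-- The two cuts around `(b, b+4)` and the modes between them. -/
lemma cuts {c t b : ℝ} (hc : 0 < c) (n₃ : ℤ) (hn₃ : n₃ = ⌊(2 * c + 1) / 2⌋ + 1)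
    (ht : t ∈ Set.Ioo (0 : ℝ) 1) (hb : b ≥ (2 * (n₃ : ℝ)) ^ 2 - 2 * c) :
    ∃ σ τ : ℝ, σ ≤ b ∧ b + 4 ≤ τ ∧
      (∃ r l : ℤ → ℝ, (∀ k, 0 ≤ r k) ∧ (∀ k, 0 ≤ l k) ∧
      (∀ k, r k + l k = msgn t σ k * (mmu t k - σ)) ∧ (∀ k, 0 < r k + l k) ∧
      (∀ k, msgn t σ k ≠ msgn t σ (k + 1) → c ^ 2 < r k * l (k + 1))) ∧
      (∃ r l : ℤ → ℝ, (∀ k, 0 ≤ r k) ∧ (∀ k, 0 ≤ l k) ∧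
      (∀ k, r k + l k = msgn t τ k * (mmu t k - τ)) ∧ (∀ k, 0 < r k + l k) ∧
      (∀ k, msgn t τ k ≠ msgn t τ (k + 1) → c ^ 2 < r k * l (k + 1))) ∧
      ∃ m₁ m₂ : ℤ, ∀ k, k ≠ m₁ → k ≠ m₂ → msgn t σ k = msgn t τ k := by
  have hn1 : (1 : ℤ) ≤ n₃ := by
    have : 0 ≤ ⌊(2 * c + 1) / 2⌋ := Int.floor_nonneg.2 (by positivity)
    omega
  have hnc : c + 1 / 2 < (n₃ : ℝ) := by
    have := Int.lt_floor_add_one ((2 * c + 1) / 2)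
    rw [hn₃]; push_cast; linarith
  have hn1' : (1 : ℝ) ≤ n₃ := by exact_mod_cast hn1
  have hb1 : 4 * c ^ 2 + 2 * c + 1 < b := by nlinarith
  have hb2 : 4 - 2 * c ≤ b := by nlinarith
  have ht' := ht
  obtain ⟨h0, h1⟩ := ht'
  obtain ⟨σ, hσ1, hσ2, hσd⟩ := cut_exists (b0 := b - 2 * c) (S := c) hc ht hc.le
    (by nlinarith [sq_nonneg (c - 1/2)]) (by linarith)
  obtain ⟨τ, hτ1, hτ2, hτd⟩ := cut_exists (b0 := b + 4) (S := c) hc ht hc.le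
    (by nlinarith [sq_nonneg (c - 1/2)]) (by linarith)
  have hσL : (1 + 5 / 8 * c) ^ 2 ≤ σ := by
    by_cases h : c ≤ 0.35
    · nlinarith
    · push Not at h
      nlinarith
  refine ⟨σ, τ, by linarith, by linarith, ?_, ?_, ?_⟩
  · refine alloc_exists hc ht hσL hσd ?_
    intro hgt
    have hd := hσd (-1)
    have hmm : mmu t (-1) = (2 - t) ^ 2 := by unfold mmu; push_cast; ring
    rw [hmm, abs_of_pos (by linarith)] at hd
    have hn2 : n₃ < 2 := by
      by_contra h
      push Not at h
      have : (2 : ℝ) ≤ n₃ := by exact_mod_cast h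
      nlinarith
    have hn3 : n₃ = 1 := by omega
    rw [hn3] at hnc
    push_cast at hnc
    exact split_exists hc (by linarith) ht (by linarith) hd
  · refine alloc_exists hc ht (by linarith) hτd ?_
    intro hgt
    nlinarith
  · classical
    have huniq : ∀ k k' : ℤ, msgn t σ k ≠ msgn t τ k → msgn t σ k' ≠ msgn t τ k' →
        (0 ≤ k ↔ 0 ≤ k') → k = k' := by
      have hmem : ∀ k, msgn t σ k ≠ msgn t τ k →
          mmu t k ∈ Set.Ioo (b - 2 * c) (b + 4 + 2 * c) := by
        intro k hk
        have hd := hσd k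
        unfold msgn at hk
        split_ifs at hk with g1 g2 g2
        · exact absurd rfl hk
        · exfalso; linarith
        · push Not at g1
          rw [abs_of_nonneg (by linarith)] at hd
          exact ⟨by linarith, by linarith⟩
        · exact absurd rfl hk
      intro k k' hk hk' hs
      exact chain_unique (S := 2 * c) ht (by linarith) (by nlinarith) (by linarith) (hmem k hk)
        (hmem k' hk') hs
    obtain ⟨m₁, hm₁⟩ : ∃ m₁ : ℤ, ∀ k, 0 ≤ k → k ≠ m₁ → msgn t σ k = msgn t τ k := by
      by_cases h : ∃ k : ℤ, 0 ≤ k ∧ msgn t σ k ≠ msgn t τ k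
      · obtain ⟨m, hm0, hm⟩ := h
        refine ⟨m, fun k hk hne => ?_⟩
        by_contra hcon
        exact hne (huniq k m hcon hm (by tauto))
      · push Not at h
        exact ⟨0, fun k hk _ => h k hk⟩
    obtain ⟨m₂, hm₂⟩ : ∃ m₂ : ℤ, ∀ k, k < 0 → k ≠ m₂ → msgn t σ k = msgn t τ k := by
      by_cases h : ∃ k : ℤ, k < 0 ∧ msgn t σ k ≠ msgn t τ k
      · obtain ⟨m, hm0, hm⟩ := h
        refine ⟨m, fun k hk hne => ?_⟩
        by_contra hcon
        exact hne (huniq k m hcon hm (by omega))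
      · push Not at h
        exact ⟨0, fun k hk _ => h k hk⟩
    refine ⟨m₁, m₂, fun k h1 h2 => ?_⟩
    rcases le_or_gt 0 k with h | h
    · exact hm₁ k h h1
    · exact hm₂ k h h2

/-- The matrix of the operator in the Fourier basis. -/
noncomputable def mop (c t : ℝ) : Module.End ℂ (ℤ → ℂ) where
  toFun a := fun k => ((mmu t k : ℝ) : ℂ) * a k + Complex.I * (c : ℂ) * (a (k + 1) + a (k - 1))
  map_add' a b := by
    funext k
    simp only [Pi.add_apply]
    ring
  map_smul' s a := by
    funext k
    simp only [Pi.smul_apply, smul_eq_mul, RingHom.id_apply]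
    ring

lemma msgn_or (t σ : ℝ) (k : ℤ) : msgn t σ k = 1 ∨ msgn t σ k = -1 := by
  unfold msgn
  split_ifs <;> simp

lemma core_hpos {c t τ : ℝ} (hc : 0 < c) (ht : t ∈ Set.Ioo (0 : ℝ) 1)
    (r l : ℤ → ℝ) (hr : ∀ k, 0 ≤ r k) (hl : ∀ k, 0 ≤ l k)
    (hw : ∀ k, r k + l k = msgn t τ k * (mmu t k - τ)) (hw0 : ∀ k, 0 < r k + l k)
    (hlink : ∀ k, msgn t τ k ≠ msgn t τ (k + 1) → c ^ 2 < r k * l (k + 1))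
    (lam : Fin 3 → ℝ) (a : Fin 3 → ℤ → ℂ) (K : Fin 3 → ℝ)
    (hK : ∀ i, ∀ k : ℤ, (1 + (k : ℝ) ^ 2) * ‖a i k‖ ≤ K i)
    (hrec : ∀ i, ∀ k : ℤ, ((mmu t k : ℝ) : ℂ) * a i k
      + Complex.I * (c : ℂ) * (a i (k + 1) + a i (k - 1)) = (lam i : ℂ) * a i k)
    (hli : ∀ x : Fin 3 → ℝ, (∀ i, 0 < x i) → (fun k => ∑ i, (x i : ℂ) * a i k) ≠ 0) :
    ∀ x : Fin 3 → ℝ, (∀ i, 0 < x i) →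
      0 < ∑' k, msgn t τ k * ((starRingEnd ℂ) (∑ i, (x i : ℂ) * a i k)
        * (∑ i, (((lam i - τ) * x i : ℝ) : ℂ) * a i k)).re := by
  intro x hx
  have hKu : ∀ k : ℤ, (1 + (k : ℝ) ^ 2) * ‖∑ i, (x i : ℂ) * a i k‖ ≤ ∑ i, x i * K i := by
    intro k
    calc (1 + (k : ℝ) ^ 2) * ‖∑ i, (x i : ℂ) * a i k‖
        ≤ (1 + (k : ℝ) ^ 2) * ∑ i, ‖(x i : ℂ) * a i k‖ := by
          gcongr
          exact norm_sum_le _ _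
      _ = ∑ i, x i * ((1 + (k : ℝ) ^ 2) * ‖a i k‖) := by
          rw [Finset.mul_sum]
          refine Finset.sum_congr rfl fun i _ => ?_
          rw [norm_mul, Complex.norm_real, Real.norm_eq_abs, abs_of_pos (hx i)]
          ring
      _ ≤ _ := Finset.sum_le_sum fun i _ => mul_le_mul_of_nonneg_left (hK i k) (hx i).le
  have hs0 : Summable fun k : ℤ => ‖∑ i, (x i : ℂ) * a i k‖ ^ 2 := by
    have := decay_summable hKu (w := fun _ => 1) (A := 1) zero_le_one (fun _ => zero_le_one)
      (fun k => by nlinarith [sq_nonneg (k : ℝ)])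
    simpa using this
  have hs : Summable fun k : ℤ => (r k + l k) * ‖∑ i, (x i : ℂ) * a i k‖ ^ 2 := by
    refine decay_summable hKu (A := 8 + 2 + |τ|) (by positivity) (fun k => (hw0 k).le) ?_
    intro k
    rw [hw k]
    have h1 : msgn t τ k * (mmu t k - τ) ≤ |mmu t k - τ| := by
      rcases msgn_or t τ k with h | h <;> rw [h]
      · rw [one_mul]; exact le_abs_self _
      · rw [neg_one_mul]; exact neg_le_abs _
    have h2 : |mmu t k - τ| ≤ mmu t k + |τ| := by
      have h := abs_sub (mmu t k) τ
      have h' : 0 ≤ mmu t k := sq_nonneg _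
      rwa [abs_of_nonneg h'] at h
    have h3 : mmu t k ≤ 8 * (k : ℝ) ^ 2 + 2 := by
      unfold mmu
      nlinarith [sq_nonneg (2 * (k : ℝ) - t), ht.1, ht.2]
    have h4 : 0 ≤ |τ| * (k : ℝ) ^ 2 := by positivity
    nlinarith [sq_nonneg (k : ℝ)]
  have key := pos_form c τ hc (mmu t) (msgn t τ) r l (msgn_or t τ) hr hl hw hw0 hlink
    (fun k => ∑ i, (x i : ℂ) * a i k) (hli x hx) hs hs0
  have he : ∀ k : ℤ, (((mmu t k - τ : ℝ) : ℂ) * (∑ i, (x i : ℂ) * a i k)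
      + Complex.I * (c : ℂ) * ((∑ i, (x i : ℂ) * a i (k + 1)) + (∑ i, (x i : ℂ) * a i (k - 1))))
      = ∑ i, (((lam i - τ) * x i : ℝ) : ℂ) * a i k := by
    intro k
    have h0 := hrec 0 k
    have h1 := hrec 1 k
    have h2 := hrec 2 k
    simp only [Fin.sum_univ_three]
    push_cast
    linear_combination (x 0 : ℂ) * h0 + (x 1 : ℂ) * h1 + (x 2 : ℂ) * h2
  simp only [he] at key
  exact key

lemma exists_alpha (v w : Fin 3 → ℂ) : ∃ α : Fin 3 → ℂ, α ≠ 0 ∧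
    ∑ i, α i * v i = 0 ∧ ∑ i, α i * w i = 0 := by
  have h := LinearMap.ker_ne_bot_of_finrank_lt (K := ℂ)
    (f := LinearMap.pi (fun j : Fin 2 => Fintype.linearCombination ℂ (![v, w] j)))
    (by simp)
  obtain ⟨α, hα, hne⟩ := (Submodule.ne_bot_iff _).1 h
  rw [LinearMap.mem_ker] at hα
  refine ⟨α, hne, ?_, ?_⟩
  · simpa [Fintype.linearCombination_apply] using congrFun hα 0
  · simpa [Fintype.linearCombination_apply] using congrFun hα 1

lemma no_three {c : ℝ} (hc : 0 < c) {n₃ : ℤ} (hn₃ : n₃ = ⌊(2 * c + 1) / 2⌋ + 1)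
    {t : ℝ} (ht : t ∈ Set.Ioo (0 : ℝ) 1) {b : ℝ} (hb : b ≥ (2 * (n₃ : ℝ)) ^ 2 - 2 * c)
    (lam : Fin 3 → ℝ) (hlam : ∀ i, lam i ∈ Set.Ioo b (b + 4)) (hinj : Function.Injective lam)
    (hev : ∀ i, mathieuEV c t (lam i : ℂ)) : False := by
  choose a ha0 haC hrec using fun i => mathieu_fourier (hev i)
  choose C hC using haC
  choose K hK using fun i => mathieu_decay hc ht (hC i) (hrec i)
  obtain ⟨σ, τ, hσ, hτ, ⟨r, l, hr, hl, hw, hw0, hlink⟩, ⟨r', l', hr', hl', hw', hw0', hlink'⟩,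
    m₁, m₂, hm⟩ := cuts hc n₃ hn₃ ht hb
  have hlin : LinearIndependent ℂ a := by
    refine (mop c t).eigenvectors_linearIndependent' (fun i => (lam i : ℂ)) ?_ a ?_
    · intro i j h
      exact hinj (Complex.ofReal_injective h)
    · intro i
      refine ⟨?_, ha0 i⟩
      rw [Module.End.mem_eigenspace_iff]
      funext k
      exact hrec i k
  obtain ⟨α, hα0, hα1, hα2⟩ := exists_alpha (fun i => a i m₁) (fun i => a i m₂)
  have hli : ∀ x : Fin 3 → ℝ, (∀ i, 0 < x i) →
      (fun k => ∑ i, (x i : ℂ) * (α i * a i k)) ≠ 0 := by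
    intro x hx h
    apply hα0
    funext i
    have := Fintype.linearIndependent_iff.1 hlin (fun i => (x i : ℂ) * α i) (by
      rw [← h]
      funext k
      simp [mul_assoc]) i
    rcases mul_eq_zero.1 this with h' | h'
    · exact absurd (Complex.ofReal_eq_zero.1 h') (hx i).ne'
    · exact h'
  have hK' : ∀ i, ∀ k : ℤ, (1 + (k : ℝ) ^ 2) * ‖α i * a i k‖ ≤ ‖α i‖ * K i := by
    intro i k
    rw [norm_mul]
    have := mul_le_mul_of_nonneg_left (hK i k) (norm_nonneg (α i))
    linarith
  have hrec' : ∀ i, ∀ k : ℤ, ((mmu t k : ℝ) : ℂ) * (α i * a i k)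
      + Complex.I * (c : ℂ) * (α i * a i (k + 1) + α i * a i (k - 1))
      = (lam i : ℂ) * (α i * a i k) := by
    intro i k
    have h : ((mmu t k : ℝ) : ℂ) * a i k
      + Complex.I * (c : ℂ) * (a i (k + 1) + a i (k - 1)) = (lam i : ℂ) * a i k := hrec i k
    linear_combination α i * h
  have hsum : ∀ i, Summable fun k : ℤ => ‖α i * a i k‖ ^ 2 := by
    intro i
    have := decay_summable (u := fun k => α i * a i k) (hK' i) (w := fun _ => 1) (A := 1)
      zero_le_one (fun _ => zero_le_one) (fun k => by nlinarith [sq_nonneg (k : ℝ)])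
    simpa using this
  have L1 := (lyap (fun i k => α i * a i k) (msgn t σ) (msgn_or t σ) hsum (fun i => lam i - σ)
    (core_hpos hc ht r l hr hl hw hw0 hlink lam (fun i k => α i * a i k) _ hK' hrec' hli)).2
    (fun i => by have := (hlam i).1; linarith)
  have L2 := (lyap (fun i k => α i * a i k) (msgn t τ) (msgn_or t τ) hsum (fun i => lam i - τ)
    (core_hpos hc ht r' l' hr' hl' hw' hw0' hlink' lam (fun i k => α i * a i k) _ hK' hrec'
      hli)).1
    (fun i => by have := (hlam i).2; linarith)
  have hE : ∑' k, msgn t σ k * ‖∑ i, α i * a i k‖ ^ 2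
      = ∑' k, msgn t τ k * ‖∑ i, α i * a i k‖ ^ 2 := by
    refine tsum_congr fun k => ?_
    by_cases h1 : k = m₁
    · subst h1
      simp only [hα1]
      simp
    by_cases h2 : k = m₂
    · subst h2
      simp only [hα2]
      simp
    rw [hm k h1 h2]
  linarith

theorem stmt8 (c : ℝ) (hc : 0 < c) (n₃ : ℤ) (hn₃ : n₃ = ⌊(2 * c + 1) / 2⌋ + 1)
    (t : ℝ) (ht : t ∈ Set.Ioo (0 : ℝ) 1) (b : ℝ) (hb : b ≥ (2 * (n₃ : ℝ)) ^ 2 - 2 * c)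
    (lam₁ lam₂ lam₃ : ℝ)
    (h₁ : lam₁ ∈ Set.Ioo b (b + 4)) (h₂ : lam₂ ∈ Set.Ioo b (b + 4))
    (h₃ : lam₃ ∈ Set.Ioo b (b + 4))
    (e₁ : mathieuEV c t (lam₁ : ℂ)) (e₂ : mathieuEV c t (lam₂ : ℂ))
    (e₃ : mathieuEV c t (lam₃ : ℂ)) :
    lam₁ = lam₂ ∨ lam₁ = lam₃ ∨ lam₂ = lam₃ := by
  by_contra hcon
  push Not at hcon
  obtain ⟨h12, h13, h23⟩ := hcon
  refine no_three hc hn₃ ht hb ![lam₁, lam₂, lam₃] ?_ ?_ ?_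
  · intro i
    fin_cases i
    · exact h₁
    · exact h₂
    · exact h₃
  · intro i j h
    fin_cases i <;> fin_cases j <;> simp_all
  · intro i
    fin_cases i
    · exact e₁
    · exact e₂
    · exact e₃
end
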